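/- arXiv:2012.13732 — 2 statements merged into one kernel-verified Lean document; each statement's English description precedes it below -/
import Mathlib

section
/- Let λ^1,…,λ^r ∈ P_n, I = ⟨λ^1,…,λ^r⟩_{S_n}, J = (x^{λ^1},…,x^{λ^r}) ⊆ R, and suppose char k = 0 or char k > n. Then for every i ≥ 0 there is an isomorphism of k-vector spaces Tor_i(I,k)^{S_n} ≅ Tor_i(J,k) between the S_n-invariant subspace of Tor_i(I,k) and Tor_i(J,k); more precisely, for every μ ∈ P_n, dim_k (Tor_i(I,k)_{⟨μ⟩})^{S_n} = dim_k Tor_i(J,k)_μ. -/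
open scoped BigOperators

noncomputable section
open Classical

/-! ## Generic (labeled) simplicial chain complexes and reduced homology over a field -/

section Homology

variable (K : Type) [Field K] {α : Type}

/-- Index type for chains: elements of `S` whose face (second component) has `j` elements. -/
def ChainIdx (S : Set (α × Finset ℕ)) (j : ℕ) : Type :=
  {q : α × Finset ℕ // q ∈ S ∧ q.2.card = j}

/-- The boundary of a basis element, with the usual simplicial signs. -/
noncomputable def bdElt (S : Set (α × Finset ℕ)) (j : ℕ) (q : ChainIdx S (j + 1)) :
    ChainIdx S j →₀ K :=
  ∑ v ∈ q.1.2,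
    if h : (q.1.1, q.1.2.erase v) ∈ S ∧ (q.1.2.erase v).card = j then
      ((-1 : K) ^ (q.1.2.filter (fun u => u ≤ v)).card) •
        Finsupp.single (⟨(q.1.1, q.1.2.erase v), h⟩ : ChainIdx S j) (1 : K)
    else 0

/-- The simplicial boundary map. -/
noncomputable def bd (S : Set (α × Finset ℕ)) (j : ℕ) :
    (ChainIdx S (j + 1) →₀ K) →ₗ[K] (ChainIdx S j →₀ K) :=
  Finsupp.linearCombination K (bdElt K S j)

/-- Cycles in homological degree `j` (chains are indexed by the cardinality of faces;
degree `j` corresponds to reduced topological degree `j - 1`). -/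
noncomputable def cycles (S : Set (α × Finset ℕ)) : (j : ℕ) → Submodule K (ChainIdx S j →₀ K)
  | 0 => ⊤
  | (i + 1) => LinearMap.ker (bd K S i)

/-- `rhd K S j` is the dimension of the reduced homology group `H̃_{j-1}` of the complex `S`
(the chain groups being finite dimensional, this is `dim` cycles `- dim` boundaries). -/
noncomputable def rhd (S : Set (α × Finset ℕ)) (j : ℕ) : ℕ :=
  Module.finrank K (cycles K S j) -
    Module.finrank K (LinearMap.range (bd K S j) ⊓ cycles K S j : Submodule K _)

/-- `hdim K S j = dim_K H̃_j(S; K)`, for `j : ℤ` (zero for `j ≤ -2`). -/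
noncomputable def hdim (S : Set (α × Finset ℕ)) (j : ℤ) : ℕ :=
  if 0 ≤ j + 1 then rhd K S (j + 1).toNat else 0

/-- View an unlabeled collection of faces as a labeled one (labels in `Unit`). -/
def lab (Δ : Set (Finset ℕ)) : Set (Unit × Finset ℕ) := {q | q.2 ∈ Δ}

/-- Dimension of reduced homology `H̃_{j-1}(Δ; K)` of a collection `Δ` of finite sets. -/
noncomputable def rhd0 (Δ : Set (Finset ℕ)) (j : ℕ) : ℕ := rhd K (lab Δ) j

/-- Dimension of reduced homology `H̃_j(Δ; K)`, `j : ℤ`. -/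
noncomputable def hdim0 (Δ : Set (Finset ℕ)) (j : ℤ) : ℕ := hdim K (lab Δ) j

end Homology

/-! ## Monomial ideals in `k[x_1, …, x_n]`, invariant under the symmetric group -/

section Poly

variable (K : Type) [Field K] (n : ℕ)

/-- The monomial `x^a` in `k[x_1, …, x_n]`. -/
noncomputable def mon (a : Fin n → ℕ) : MvPolynomial (Fin n) K :=
  MvPolynomial.monomial (Finsupp.equivFunOnFinite.symm a) 1

/-- A monomial ideal: an ideal generated by a set of monomials. -/
def IsMonomialIdeal (I : Ideal (MvPolynomial (Fin n) K)) : Prop :=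
  ∃ S : Set (Fin n → ℕ), I = Ideal.span (mon K n '' S)

/-- `I` is invariant under the action of `S_n` permuting the variables. -/
def IsSymmetricIdeal (I : Ideal (MvPolynomial (Fin n) K)) : Prop :=
  ∀ σ : Equiv.Perm (Fin n), Ideal.map (MvPolynomial.rename σ).toRingHom I = I

end Poly

/-! ## Partitions given by blocks `(d_1^{p_1}, …, d_s^{p_s}, 0^{p_{s+1}})` -/

section Blocks

/-- `cumsum p k = p 0 + ⋯ + p (k-1)`. -/
def cumsum (p : ℕ → ℕ) (k : ℕ) : ℕ := ∑ j ∈ Finset.range k, p j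

/-- The index of the block (among blocks `0, …, s`) containing position `i`,
for blocks of sizes `p 0, …, p (s-1)` followed by a final block. -/
def blkOf (p : ℕ → ℕ) (s i : ℕ) : ℕ :=
  ((Finset.range s).filter fun k => cumsum p (k + 1) ≤ i).card

/-- The partition `μ = (d_0^{p_0}, …, d_{s-1}^{p_{s-1}}, 0^{p_s})` (0-indexed blocks),
as a function of the position `i ∈ {0, …, n-1}` where `n = cumsum p (s+1)`. -/
def muOf (s : ℕ) (d p : ℕ → ℕ) (i : ℕ) : ℕ :=
  if blkOf p s i < s then d (blkOf p s i) else 0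

/-- The partition `μ ∖ c`, obtained from `μ` by replacing, for each `k`, the last `c k` of
the parts equal to `d k` by `d k - 1`. -/
def muMinus (s : ℕ) (d p c : ℕ → ℕ) (i : ℕ) : ℕ :=
  if blkOf p s i < s then
    (if p (blkOf p s i) - c (blkOf p s i) ≤ i - cumsum p (blkOf p s i) then
      d (blkOf p s i) - 1 else d (blkOf p s i))
  else 0

/-- Indicator vector of a finite set `F`. -/
def eF (F : Finset ℕ) (j : ℕ) : ℕ := if j ∈ F then 1 else 0

end Blocks

/-! ## The simplicial complexes `Δ^{μ,c}(I)` and `Γ^{μ,c}(I)` -/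

section Complexes

variable (K : Type) [Field K] (n : ℕ)

/-- The simplicial complex `Δ^{μ,c}(I) = {F ⊆ [s] : μ ∖ (c + e_F) ∈ P(I)}` (vertices are
`0, …, s-1`), for `μ = (d_0^{p_0}, …, d_{s-1}^{p_{s-1}}, 0^{p_s})` and `c ≤ p(μ)`. -/
def DeltaCx (I : Ideal (MvPolynomial (Fin n) K)) (s : ℕ) (d p c : ℕ → ℕ) :
    Set (Finset ℕ) :=
  {F | F ⊆ Finset.range s ∧
    mon K n (fun i => muMinus s d p (fun j => c j + eF F j) i.val) ∈ I}

/-- The Alexander dual complex `Γ^{μ,c}(I) = {F ⊆ [s] : μ ∖ (c + e_{[s]∖F}) ∈ O(I)}`. -/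
def GammaCx (I : Ideal (MvPolynomial (Fin n) K)) (s : ℕ) (d p c : ℕ → ℕ) :
    Set (Finset ℕ) :=
  {F | F ⊆ Finset.range s ∧
    mon K n (fun i => muMinus s d p
      (fun j => c j + (if j < s ∧ j ∉ F then 1 else 0)) i.val) ∉ I}

/-- `γ_i^{μ,c}(I) = dim_K H̃_{i-1}(Δ^{μ,c}(I); K)`. -/
noncomputable def gammaDim (I : Ideal (MvPolynomial (Fin n) K)) (s : ℕ) (d p c : ℕ → ℕ)
    (i : ℕ) : ℕ :=
  rhd0 K (DeltaCx K n I s d p c) i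

end Complexes

/-! ## Multigraded Tor via the Koszul complex

For a monomial ideal `I`, the multidegree-`a` strand of the Koszul complex `K_•(I)` is the
(shifted) reduced chain complex of the simplicial complex
`Δ_a^I = {F ⊆ [n] : a - e_F ≥ 0, x^{a - e_F} ∈ I}`, so that
`dim_K Tor_i(I, K)_a = dim_K H̃_{i-1}(Δ_a^I; K)`, and similarly for `R/I` with the
condition `x^{a-e_F} ∉ I`. -/

section Tor

variable (K : Type) [Field K] (n : ℕ)

/-- The Koszul simplicial complex of the ideal `I` in multidegree `a`. -/
def KosI (I : Ideal (MvPolynomial (Fin n) K)) (a : Fin n → ℕ) : Set (Finset ℕ) :=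
  {F | F ⊆ Finset.range n ∧ (∀ i : Fin n, (i : ℕ) ∈ F → 1 ≤ a i) ∧
    mon K n (fun i => a i - eF F i.val) ∈ I}

/-- The Koszul complex of `R/I` in multidegree `a`. -/
def KosQ (I : Ideal (MvPolynomial (Fin n) K)) (a : Fin n → ℕ) : Set (Finset ℕ) :=
  {F | F ⊆ Finset.range n ∧ (∀ i : Fin n, (i : ℕ) ∈ F → 1 ≤ a i) ∧
    mon K n (fun i => a i - eF F i.val) ∉ I}

/-- `dim_K Tor_i(I, K)_a`, for a monomial ideal `I` and a multidegree `a ∈ ℤ^n`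
(components with a negative coordinate vanish, so only `a ∈ ℕ^n` is needed). -/
noncomputable def torDim (I : Ideal (MvPolynomial (Fin n) K)) (i : ℕ) (a : Fin n → ℕ) : ℕ :=
  rhd0 K (KosI K n I a) i

/-- `dim_K Tor_i(R/I, K)_a` for a monomial ideal `I`. -/
noncomputable def torQDim (I : Ideal (MvPolynomial (Fin n) K)) (i : ℕ) (a : Fin n → ℕ) : ℕ :=
  rhd0 K (KosQ K n I a) i

/-- `dim_K Tor_i(I, K)_{⟨μ⟩}`: the sum of `dim_K Tor_i(I, K)_a` over all rearrangements `a`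
of the partition `μ`. -/
noncomputable def torDimSym (I : Ideal (MvPolynomial (Fin n) K)) (i : ℕ) (μ : Fin n → ℕ) : ℕ :=
  ∑ a ∈ Finset.image (fun σ : Equiv.Perm (Fin n) => μ ∘ σ) Finset.univ, torDim K n I i a

/-- `dim_K Tor_i(R/I, K)_{⟨μ⟩}`. -/
noncomputable def torQDimSym (I : Ideal (MvPolynomial (Fin n) K)) (i : ℕ) (μ : Fin n → ℕ) : ℕ :=
  ∑ a ∈ Finset.image (fun σ : Equiv.Perm (Fin n) => μ ∘ σ) Finset.univ, torQDim K n I i a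

end Tor

/-! ## Extended partitions in `P_n^∞` and the dual generators of an `S_n`-invariant
monomial ideal -/

section ExtendedPartitions

variable (K : Type) [Field K] (n : ℕ)

/-- `ℓ(μ)`: the number of entries of `μ ∈ P_n^∞` equal to `∞`. -/
def ellInf (μ : Fin n → ℕ∞) : ℕ := (Finset.univ.filter fun i => μ i = ⊤).card

/-- The largest finite entry of `μ ∈ P_n^∞` (i.e. the first finite entry, `μ` being
weakly decreasing). -/
def topVal (μ : Fin n → ℕ∞) : ℕ := Finset.univ.sup fun i => (μ i).toNat

/-- `μ^+ ∈ P_n`: each `∞` entry of `μ` is replaced by (largest finite entry)` + 1`. -/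
def plusOf (μ : Fin n → ℕ∞) (i : Fin n) : ℕ :=
  if μ i = ⊤ then topVal n μ + 1 else (μ i).toNat

/-- `μ̃ = μ^+ + (0^{ℓ(μ)}, 1^{n - ℓ(μ)}) ∈ P_n`. -/
def tildeOf (μ : Fin n → ℕ∞) (i : Fin n) : ℕ :=
  if μ i = ⊤ then topVal n μ + 1 else (μ i).toNat + 1

/-- The ideal `Q_μ = ∩_{σ ∈ S_n} σ((x_k^{μ_k + 1}, …, x_n^{μ_n + 1}))`, where
`μ_k, …, μ_n` are the finite entries of `μ ∈ P_n^∞`. -/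
noncomputable def Qgen (μ : Fin n → ℕ∞) : Ideal (MvPolynomial (Fin n) K) :=
  ⨅ σ : Equiv.Perm (Fin n),
    Ideal.map (MvPolynomial.rename σ).toRingHom
      (Ideal.span {g | ∃ i : Fin n, μ i ≠ ⊤ ∧ g = MvPolynomial.X i ^ ((μ i).toNat + 1)})

/-- `Λ` is the (finite) set of dual generators of `I`, i.e. `I = ∩_{μ ∈ Λ} Q_μ` is the
irredundant presentation of `I` by ideals `Q_μ`. -/
def IsDualPresentation (I : Ideal (MvPolynomial (Fin n) K))
    (Λ : Finset (Fin n → ℕ∞)) : Prop :=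
  (∀ μ ∈ Λ, Antitone μ) ∧ (I = ⨅ μ ∈ Λ, Qgen K n μ) ∧
    ∀ μ ∈ Λ, I ≠ ⨅ ρ ∈ Λ, ⨅ _ : ρ ≠ μ, Qgen K n ρ

/-- The partial order `≼` on dual generators: `μ ≼ ρ` iff `μ̃ ≤ ρ̃` (componentwise) and
`ℓ(μ) - ℓ(ρ) ≤ |ρ̃| - |μ̃|`. -/
def preceq (μ ρ : Fin n → ℕ∞) : Prop :=
  (∀ i, tildeOf n μ i ≤ tildeOf n ρ i) ∧
    (∑ i, tildeOf n μ i) + ellInf n μ ≤ (∑ i, tildeOf n ρ i) + ellInf n ρ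

/-- The extended partition `ρ = (∞^{p_0}, d_1^{p_1}, …, d_s^{p_s}) ∈ P_n^∞`
(so `n = p 0 + p 1 + ⋯ + p s`), as a function of the position `i ∈ {0, …, n-1}`. -/
def rhoOf (s : ℕ) (d p : ℕ → ℕ) (i : ℕ) : ℕ∞ :=
  if blkOf p (s + 1) i = 0 then ⊤ else ((d (blkOf p (s + 1) i) : ℕ) : ℕ∞)

end ExtendedPartitions

/-! ## The `S_n`-action on the `⟨μ⟩`-strand of the Koszul complex, and invariants -/

section Equivariant

variable (K : Type) [Field K] (n : ℕ)

/-- The action of `σ ∈ S_n` on `{0, …, n-1} ⊆ ℕ`. -/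
def permNat (σ : Equiv.Perm (Fin n)) (j : ℕ) : ℕ :=
  if h : j < n then (σ ⟨j, h⟩ : ℕ) else j

/-- The action of `σ ∈ S_n` on subsets of `{0, …, n-1}`. -/
def permFinset (σ : Equiv.Perm (Fin n)) (F : Finset ℕ) : Finset ℕ :=
  F.image (permNat n σ)

/-- The sign exponent of `σ` acting on the ordered wedge `e_F`: the number of inversions
of `σ` on `F`. -/
def permSign (σ : Equiv.Perm (Fin n)) (F : Finset ℕ) : ℕ :=
  ((F ×ˢ F).filter fun uv => uv.1 < uv.2 ∧ permNat n σ uv.2 < permNat n σ uv.1).card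

/-- The `⟨μ⟩`-strand of the Koszul complex of `I`: labeled faces `(a, F)` with `a` a
rearrangement of `μ`, `F ⊆ [n]`, `a - e_F ≥ 0` and `x^{a - e_F} ∈ I`. -/
def KosSym (I : Ideal (MvPolynomial (Fin n) K)) (μ : Fin n → ℕ) :
    Set ((Fin n → ℕ) × Finset ℕ) :=
  {q | (∃ σ : Equiv.Perm (Fin n), q.1 = μ ∘ σ) ∧ q.2 ⊆ Finset.range n ∧
    (∀ i : Fin n, (i : ℕ) ∈ q.2 → 1 ≤ q.1 i) ∧
    mon K n (fun i => q.1 i - eF q.2 i.val) ∈ I}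

/-- The image of a basis chain under `σ ∈ S_n`: `σ(x^{a-e_F} e_F) = ± x^{σ(a)-e_{σF}} e_{σF}`. -/
noncomputable def actElt (S : Set ((Fin n → ℕ) × Finset ℕ)) (σ : Equiv.Perm (Fin n))
    (j : ℕ) (q : ChainIdx S j) : ChainIdx S j →₀ K :=
  if h : (q.1.1 ∘ ⇑σ⁻¹, permFinset n σ q.1.2) ∈ S ∧ (permFinset n σ q.1.2).card = j then
    ((-1 : K) ^ permSign n σ q.1.2) •
      Finsupp.single (⟨(q.1.1 ∘ ⇑σ⁻¹, permFinset n σ q.1.2), h⟩ : ChainIdx S j) (1 : K)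
  else 0

/-- The (signed) action of `σ ∈ S_n` on chains of a labeled complex. -/
noncomputable def permAct (S : Set ((Fin n → ℕ) × Finset ℕ)) (σ : Equiv.Perm (Fin n))
    (j : ℕ) : (ChainIdx S j →₀ K) →ₗ[K] (ChainIdx S j →₀ K) :=
  Finsupp.linearCombination K (actElt K n S σ j)

/-- Cycles representing `S_n`-invariant homology classes: cycles `z` such that
`σ z - z` is a boundary for every `σ ∈ S_n`. -/
noncomputable def invCycles (S : Set ((Fin n → ℕ) × Finset ℕ)) (j : ℕ) :
    Submodule K (ChainIdx S j →₀ K) :=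
  cycles K S j ⊓ ⨅ σ : Equiv.Perm (Fin n),
    Submodule.comap (permAct K n S σ j - LinearMap.id) (LinearMap.range (bd K S j))

/-- `dim_K (Tor_j(I, K)_{⟨μ⟩})^{S_n}`, computed from the `⟨μ⟩`-strand of the Koszul
complex: invariant cycles modulo boundaries. -/
noncomputable def torInvDim (I : Ideal (MvPolynomial (Fin n) K)) (μ : Fin n → ℕ)
    (j : ℕ) : ℕ :=
  Module.finrank K (invCycles K n (KosSym K n I μ) j) -
    Module.finrank K
      (LinearMap.range (bd K (KosSym K n I μ) j) ⊓ invCycles K n (KosSym K n I μ) j :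
        Submodule K _)

end Equivariant

/-- The `S_n`-invariant monomial ideal `⟨λ^1, …, λ^r⟩_{S_n}` generated by the
partitions `L 0, …, L (r-1)`. -/
def symIdeal (K : Type) [Field K] (n r : ℕ) (L : Fin r → Fin n → ℕ) :
    Ideal (MvPolynomial (Fin n) K) :=
  Ideal.span {f | ∃ (j : Fin r) (σ : Equiv.Perm (Fin n)),
    f = MvPolynomial.rename σ (mon K n (L j))}

/-- The unsymmetrization `J = (x^{λ^1}, …, x^{λ^r})`. -/
def unsymIdeal (K : Type) [Field K] (n r : ℕ) (L : Fin r → Fin n → ℕ) :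
    Ideal (MvPolynomial (Fin n) K) :=
  Ideal.span {f | ∃ j : Fin r, f = mon K n (L j)}

/-! ## Exterior multiplication and contraction on signed finite sets -/

section Exterior

variable (K : Type) [Field K]

/-- The sign of moving `v` to its place in the increasing enumeration of `F`. -/
def posSign (v : ℕ) (F : Finset ℕ) : K := (-1) ^ (F.filter fun u => u < v).card

/-- Exterior multiplication by the basis vector `v`. -/
def wedgeVec (v : ℕ) : (Finset ℕ →₀ K) →ₗ[K] (Finset ℕ →₀ K) :=
  Finsupp.linearCombination K fun F =>
    if v ∈ F then 0 else posSign K v F • Finsupp.single (insert v F) 1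

/-- Contraction against the sum of all coordinates. -/
def contr : (Finset ℕ →₀ K) →ₗ[K] (Finset ℕ →₀ K) :=
  Finsupp.linearCombination K fun F => ∑ v ∈ F, posSign K v F • Finsupp.single (F.erase v) 1

/-- The wedge product of a list of basis vectors. -/
def wedgeList (l : List ℕ) : Finset ℕ →₀ K :=
  l.foldr (fun v x => wedgeVec K v x) (Finsupp.single ∅ 1)

/-- The map induced on exterior chains by a map of vertices. -/
def wedgeMap (p : ℕ → ℕ) : (Finset ℕ →₀ K) →ₗ[K] (Finset ℕ →₀ K) :=
  Finsupp.linearCombination K fun F => wedgeList K ((F.sort (· ≤ ·)).map p)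

/-- The prism over a wedge product of basis vectors, between the identity and `wedgeMap p`. -/
def prismList (p : ℕ → ℕ) : List ℕ → (Finset ℕ →₀ K)
  | [] => 0
  | v :: l => wedgeVec K (p v) (wedgeList K (v :: l) - prismList p l)

/-- The prism operator, a chain homotopy between the identity and `wedgeMap p`. -/
def prism (p : ℕ → ℕ) : (Finset ℕ →₀ K) →ₗ[K] (Finset ℕ →₀ K) :=
  Finsupp.linearCombination K fun F => prismList K p (F.sort (· ≤ ·))

variable {K}

lemma posSign_insert {w : ℕ} {F : Finset ℕ} (h : w ∉ F) (v : ℕ) :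
    posSign K v (insert w F) = (if w < v then -1 else 1) * posSign K v F := by
  unfold posSign
  rw [Finset.filter_insert]
  split_ifs with hw
  · rw [Finset.card_insert_of_notMem (by simp [h]), pow_succ]; ring
  · simp

lemma posSign_mul_self (v : ℕ) (F : Finset ℕ) : posSign K v F * posSign K v F = 1 := by
  unfold posSign
  rw [← mul_pow]; simp

lemma posSign_of_lt {v : ℕ} {F : Finset ℕ} (h : ∀ u ∈ F, v < u) : posSign K v F = 1 := by
  unfold posSign
  rw [Finset.filter_eq_empty_iff.mpr fun u hu => (h u hu).le.not_gt]; simp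

lemma wedgeVec_single (v : ℕ) (F : Finset ℕ) :
    wedgeVec K v (Finsupp.single F 1) =
      if v ∈ F then 0 else posSign K v F • Finsupp.single (insert v F) 1 := by
  simp [wedgeVec]

lemma contr_single (F : Finset ℕ) :
    contr K (Finsupp.single F 1) =
      ∑ v ∈ F, posSign K v F • Finsupp.single (F.erase v) 1 := by
  simp [contr]

lemma wedgeVec_single_of_lt {v : ℕ} {F : Finset ℕ} (h : ∀ u ∈ F, v < u) :
    wedgeVec K v (Finsupp.single F 1) = Finsupp.single (insert v F) 1 := by
  rw [wedgeVec_single, if_neg fun hv => lt_irrefl _ (h v hv), posSign_of_lt h, one_smul]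

lemma wedgeVec_anticomm (v w : ℕ) (x : Finset ℕ →₀ K) :
    wedgeVec K v (wedgeVec K w x) = -wedgeVec K w (wedgeVec K v x) := by
  suffices h : wedgeVec K v ∘ₗ wedgeVec K w = -(wedgeVec K w ∘ₗ wedgeVec K v) from
    LinearMap.congr_fun h x
  ext1 F
  ext1
  simp only [LinearMap.coe_comp, Function.comp_apply, Finsupp.lsingle_apply, LinearMap.neg_apply,
    wedgeVec_single]
  by_cases hv : v ∈ F <;> by_cases hw : w ∈ F
  · simp [hv, hw]
  · simp [hv, hw, wedgeVec_single, -Finsupp.smul_single]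
  · simp [hv, hw, wedgeVec_single, -Finsupp.smul_single]
  · rw [if_neg hv, if_neg hw, map_smul, map_smul, wedgeVec_single, wedgeVec_single]
    rcases lt_trichotomy v w with h | rfl | h
    · rw [if_neg (by simp [hv, h.ne]), if_neg (by simp [hw, h.ne']), posSign_insert hv,
        posSign_insert hw, if_pos h, if_neg h.not_gt, Finset.insert_comm v w, smul_smul, smul_smul,
        ← neg_smul]
      congr 1; ring
    · simp
    · rw [if_neg (by simp [hv, h.ne']), if_neg (by simp [hw, h.ne]), posSign_insert hv,
        posSign_insert hw, if_pos h, if_neg h.not_gt, Finset.insert_comm v w, smul_smul, smul_smul,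
        ← neg_smul]
      congr 1; ring

lemma wedgeVec_self (v : ℕ) (x : Finset ℕ →₀ K) : wedgeVec K v (wedgeVec K v x) = 0 := by
  suffices h : wedgeVec K v ∘ₗ wedgeVec K v = 0 from LinearMap.congr_fun h x
  ext1 F
  ext1
  by_cases hv : v ∈ F <;> simp [hv, wedgeVec_single, -Finsupp.smul_single]

lemma contr_wedgeVec (v : ℕ) (x : Finset ℕ →₀ K) :
    contr K (wedgeVec K v x) = x - wedgeVec K v (contr K x) := by
  suffices h : contr K ∘ₗ wedgeVec K v = LinearMap.id - wedgeVec K v ∘ₗ contr K from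
    LinearMap.congr_fun h x
  ext1 F
  ext1
  simp only [LinearMap.coe_comp, Function.comp_apply, Finsupp.lsingle_apply, LinearMap.sub_apply,
    LinearMap.id_apply, wedgeVec_single, contr_single, map_sum, map_smul]
  by_cases hv : v ∈ F
  · rw [if_pos hv, map_zero, Finset.sum_eq_single_of_mem v hv]
    · have hs : posSign K v F = posSign K v (F.erase v) := by
        conv_lhs => rw [← Finset.insert_erase hv, posSign_insert (Finset.notMem_erase v F)]
        simp
      rw [if_neg (Finset.notMem_erase v F), Finset.insert_erase hv, smul_smul, hs,
        posSign_mul_self, one_smul, sub_self]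
    · intro u hu huv
      rw [if_pos (Finset.mem_erase.mpr ⟨huv.symm, hv⟩), smul_zero]
  · rw [if_neg hv, map_smul, contr_single, Finset.sum_insert hv, Finset.erase_insert hv,
      posSign_insert hv, if_neg (lt_irrefl v), one_mul, smul_add, smul_smul, posSign_mul_self,
      one_smul, sub_eq_add_neg, Finset.smul_sum, ← Finset.sum_neg_distrib]
    congr 1
    refine Finset.sum_congr rfl fun u hu => ?_
    have huv : u ≠ v := fun h => hv (h ▸ hu)
    have hve : v ∉ F.erase u := fun h => hv (Finset.mem_of_mem_erase h)
    have hs : posSign K v F = (if u < v then -1 else 1) * posSign K v (F.erase u) := by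
      conv_lhs => rw [← Finset.insert_erase hu, posSign_insert (Finset.notMem_erase u F)]
    rw [if_neg hve, Finset.erase_insert_of_ne huv.symm, posSign_insert hv, hs, smul_smul,
      smul_smul, ← neg_smul]
    congr 1
    rcases lt_or_gt_of_ne huv with h | h
    · rw [if_pos h, if_neg h.not_gt]; ring
    · rw [if_neg h.not_gt, if_pos h]; ring

lemma contr_single_empty : contr K (Finsupp.single ∅ 1) = 0 := by simp [contr_single]

lemma wedgeMap_single (p : ℕ → ℕ) (F : Finset ℕ) :
    wedgeMap K p (Finsupp.single F 1) = wedgeList K ((F.sort (· ≤ ·)).map p) := by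
  simp [wedgeMap]

lemma wedgeMap_single_empty (p : ℕ → ℕ) :
    wedgeMap K p (Finsupp.single ∅ 1) = Finsupp.single ∅ 1 := by
  simp [wedgeMap_single, wedgeList]

lemma sort_insert_of_lt {v : ℕ} {F : Finset ℕ} (h : ∀ u ∈ F, v < u) :
    (insert v F).sort (· ≤ ·) = v :: F.sort (· ≤ ·) :=
  Finset.sort_insert _ (fun u hu => (h u hu).le) fun hv => lt_irrefl _ (h v hv)

lemma wedgeMap_single_insert (p : ℕ → ℕ) {v : ℕ} {F : Finset ℕ} (h : ∀ u ∈ F, v < u) :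
    wedgeMap K p (Finsupp.single (insert v F) 1) =
      wedgeVec K (p v) (wedgeMap K p (Finsupp.single F 1)) := by
  simp [wedgeMap_single, sort_insert_of_lt h, wedgeList]

lemma wedgeMap_wedgeVec (p : ℕ → ℕ) (v : ℕ) (x : Finset ℕ →₀ K) :
    wedgeMap K p (wedgeVec K v x) = wedgeVec K (p v) (wedgeMap K p x) := by
  suffices h : wedgeMap K p ∘ₗ wedgeVec K v = wedgeVec K (p v) ∘ₗ wedgeMap K p from
    LinearMap.congr_fun h x
  ext1 F
  ext1
  simp only [LinearMap.coe_comp, Function.comp_apply, Finsupp.lsingle_apply]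
  induction F using Finset.induction_on_min with
  | empty => rw [wedgeVec_single_of_lt (by simp), wedgeMap_single_insert _ (by simp)]
  | insert u F hu ih =>
    rcases lt_trichotomy v u with h | rfl | h
    · have hv : ∀ x ∈ insert u F, v < x := by
        simp only [Finset.mem_insert, forall_eq_or_imp]
        exact ⟨h, fun x hx => h.trans (hu x hx)⟩
      rw [wedgeVec_single_of_lt hv, wedgeMap_single_insert _ hv]
    · rw [wedgeMap_single_insert _ hu, ← wedgeVec_single_of_lt hu, wedgeVec_self, wedgeVec_self,
        map_zero]
    · rw [wedgeMap_single_insert _ hu, wedgeVec_anticomm, ← ih, ← wedgeVec_single_of_lt hu,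
        wedgeVec_anticomm, map_neg, wedgeVec_single v F]
      split_ifs with hF
      · simp
      · have hv : ∀ x ∈ insert v F, u < x := by
          simp only [Finset.mem_insert, forall_eq_or_imp]
          exact ⟨h, hu⟩
        simp only [map_smul, wedgeVec_single_of_lt hv, wedgeMap_single_insert _ hv]

/-- Linear maps intertwining exterior multiplications are determined by their value on the unit. -/
lemma linearMap_ext_wedgeVec {f g : (Finset ℕ →₀ K) →ₗ[K] (Finset ℕ →₀ K)}
    (h0 : f (Finsupp.single ∅ 1) = g (Finsupp.single ∅ 1))
    (h : ∀ v x, f x = g x → f (wedgeVec K v x) = g (wedgeVec K v x)) : f = g := by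
  ext1 F
  ext1
  simp only [LinearMap.coe_comp, Function.comp_apply, Finsupp.lsingle_apply]
  induction F using Finset.induction_on_min with
  | empty => exact h0
  | insert u F hu ih => rw [← wedgeVec_single_of_lt hu]; exact h _ _ ih

lemma contr_wedgeMap (p : ℕ → ℕ) (x : Finset ℕ →₀ K) :
    contr K (wedgeMap K p x) = wedgeMap K p (contr K x) := by
  suffices h : contr K ∘ₗ wedgeMap K p = wedgeMap K p ∘ₗ contr K from LinearMap.congr_fun h x
  refine linearMap_ext_wedgeVec ?_ fun v x hx => ?_
  · simp [wedgeMap_single_empty, contr_single_empty]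
  · simp only [LinearMap.coe_comp, Function.comp_apply] at hx ⊢
    rw [wedgeMap_wedgeVec, contr_wedgeVec, hx, contr_wedgeVec, map_sub, wedgeMap_wedgeVec]

lemma wedgeMap_wedgeMap (p q : ℕ → ℕ) (x : Finset ℕ →₀ K) :
    wedgeMap K p (wedgeMap K q x) = wedgeMap K (p ∘ q) x := by
  suffices h : wedgeMap K p ∘ₗ wedgeMap K q = wedgeMap K (p ∘ q) from LinearMap.congr_fun h x
  refine linearMap_ext_wedgeVec ?_ fun v x hx => ?_
  · simp [wedgeMap_single_empty]
  · simp only [LinearMap.coe_comp, Function.comp_apply] at hx ⊢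
    rw [wedgeMap_wedgeVec, wedgeMap_wedgeVec, wedgeMap_wedgeVec, hx, Function.comp_apply]

lemma wedgeMap_id (x : Finset ℕ →₀ K) : wedgeMap K id x = x := by
  suffices h : wedgeMap K id = LinearMap.id from LinearMap.congr_fun h x
  refine linearMap_ext_wedgeVec ?_ fun v x hx => ?_
  · simp [wedgeMap_single_empty]
  · rw [wedgeMap_wedgeVec, hx]; rfl

lemma wedgeMap_congr {p q : ℕ → ℕ} {F : Finset ℕ} (h : ∀ v ∈ F, p v = q v) :
    wedgeMap K p (Finsupp.single F 1) = wedgeMap K q (Finsupp.single F 1) := by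
  rw [wedgeMap_single, wedgeMap_single,
    List.map_congr_left fun v hv => h v ((Finset.mem_sort _).mp hv)]

/-- A transposition of two vertices of a face reverses its orientation. -/
lemma wedgeMap_swap {p : ℕ → ℕ} {u v : ℕ} {F : Finset ℕ} (hu : u ∈ F) (hv : v ∈ F) (huv : u ≠ v)
    (hpu : p u = v) (hpv : p v = u) (hp : ∀ w ∈ F, w ≠ u → w ≠ v → p w = w) :
    wedgeMap K p (Finsupp.single F 1) = -Finsupp.single F 1 := by
  have key : ∀ {w : ℕ} {G : Finset ℕ}, w ∉ G → Finsupp.single (insert w G) (1 : K) =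
      posSign K w G • wedgeVec K w (Finsupp.single G 1) := fun {w G} hw => by
    rw [wedgeVec_single, if_neg hw, smul_smul, posSign_mul_self, one_smul]
  obtain ⟨G, hvG, hG⟩ : ∃ G, v ∉ G ∧ F.erase u = insert v G :=
    ⟨(F.erase u).erase v, Finset.notMem_erase _ _,
      (Finset.insert_erase (Finset.mem_erase.mpr ⟨huv.symm, hv⟩)).symm⟩
  have huG : u ∉ insert v G := hG ▸ Finset.notMem_erase u F
  have hF : F = insert u (insert v G) := by rw [← hG, Finset.insert_erase hu]
  have hfix : wedgeMap K p (Finsupp.single G 1) = Finsupp.single G 1 := by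
    rw [wedgeMap_congr (q := id), wedgeMap_id]
    intro w hw
    refine hp w (by simp [hF, hw]) ?_ ?_
    · rintro rfl; exact huG (by simp [hw])
    · rintro rfl; exact hvG hw
  rw [hF, key huG, key hvG]
  simp only [map_smul, wedgeMap_wedgeVec, hpu, hpv, hfix]
  rw [wedgeVec_anticomm v u]
  simp

lemma prism_single_empty (p : ℕ → ℕ) : prism K p (Finsupp.single ∅ 1) = 0 := by
  simp [prism, prismList]

lemma wedgeList_sort (F : Finset ℕ) :
    wedgeList K (F.sort (· ≤ ·)) = Finsupp.single F 1 := by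
  simpa [wedgeMap_single] using wedgeMap_id (Finsupp.single F (1 : K))

lemma prism_single_insert (p : ℕ → ℕ) {v : ℕ} {F : Finset ℕ} (h : ∀ u ∈ F, v < u) :
    prism K p (Finsupp.single (insert v F) 1) =
      wedgeVec K (p v) (Finsupp.single (insert v F) 1 - prism K p (Finsupp.single F 1)) := by
  simp only [prism, Finsupp.linearCombination_single, one_smul]
  rw [sort_insert_of_lt h, prismList, ← sort_insert_of_lt h, wedgeList_sort]

lemma contr_prism (p : ℕ → ℕ) (x : Finset ℕ →₀ K) :
    contr K (prism K p x) + prism K p (contr K x) = x - wedgeMap K p x := by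
  suffices h : contr K ∘ₗ prism K p + prism K p ∘ₗ contr K = LinearMap.id - wedgeMap K p from
    LinearMap.congr_fun h x
  ext1 F
  ext1
  simp only [LinearMap.coe_comp, Function.comp_apply, Finsupp.lsingle_apply, LinearMap.add_apply,
    LinearMap.sub_apply, LinearMap.id_apply]
  induction F using Finset.induction_on_min with
  | empty => simp [prism_single_empty, contr_single_empty, wedgeMap_single_empty]
  | insert v F hv ih =>
    have hmul : prism K p (wedgeVec K v (contr K (Finsupp.single F 1))) =
        wedgeVec K (p v) (wedgeVec K v (contr K (Finsupp.single F 1)) -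
          prism K p (contr K (Finsupp.single F 1))) := by
      simp only [contr_single, map_sum, map_smul, ← Finset.sum_sub_distrib, ← smul_sub]
      refine Finset.sum_congr rfl fun u _ => ?_
      have hv' : ∀ w ∈ F.erase u, v < w := fun w hw => hv w (Finset.mem_of_mem_erase hw)
      rw [wedgeVec_single_of_lt hv', prism_single_insert _ hv']
    have hc := contr_wedgeVec v (Finsupp.single F (1 : K))
    rw [wedgeVec_single_of_lt hv] at hc
    rw [prism_single_insert _ hv, contr_wedgeVec, map_sub, hc, map_sub (prism K p), hmul,
      wedgeMap_single_insert _ hv, eq_sub_of_add_eq ih]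
    simp only [map_sub]
    abel

/-- Chains on the `j`-element subsets of `F`. -/
abbrev subsetChains (K : Type) [Field K] (F : Finset ℕ) (j : ℕ) : Submodule K (Finset ℕ →₀ K) :=
  Finsupp.supported K K {G | G ⊆ F ∧ G.card = j}

lemma subsetChains_mono {F F' : Finset ℕ} (h : F ⊆ F') (j : ℕ) :
    subsetChains K F j ≤ subsetChains K F' j :=
  Finsupp.supported_mono fun _ hG => ⟨hG.1.trans h, hG.2⟩

lemma single_mem_subsetChains (F : Finset ℕ) : Finsupp.single F 1 ∈ subsetChains K F F.card :=
  Finsupp.single_mem_supported _ _ ⟨subset_rfl, rfl⟩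

lemma wedgeVec_mem_subsetChains (v : ℕ) {F : Finset ℕ} {j : ℕ} {x : Finset ℕ →₀ K}
    (hx : x ∈ subsetChains K F j) : wedgeVec K v x ∈ subsetChains K (insert v F) (j + 1) := by
  revert x
  change subsetChains K F j ≤ (subsetChains K (insert v F) (j + 1)).comap (wedgeVec K v)
  rw [subsetChains, Finsupp.supported_eq_span_single, Submodule.span_le]
  rintro _ ⟨G, ⟨hG, rfl⟩, rfl⟩
  rw [SetLike.mem_coe, Submodule.mem_comap, wedgeVec_single]
  split_ifs with h
  · exact zero_mem _
  · exact Submodule.smul_mem _ _ (Finsupp.single_mem_supported _ _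
      ⟨Finset.insert_subset_insert v hG, Finset.card_insert_of_notMem h⟩)

lemma wedgeMap_single_mem (p : ℕ → ℕ) (F : Finset ℕ) :
    wedgeMap K p (Finsupp.single F 1) ∈ subsetChains K (F.image p) F.card := by
  induction F using Finset.induction_on_min with
  | empty => simpa [wedgeMap_single_empty] using single_mem_subsetChains (K := K) ∅
  | insert v F hv ih =>
    rw [wedgeMap_single_insert _ hv, Finset.image_insert,
      Finset.card_insert_of_notMem fun h => lt_irrefl _ (hv v h)]
    exact wedgeVec_mem_subsetChains _ ih

lemma wedgeMap_single_of_not_injOn {p : ℕ → ℕ} {F : Finset ℕ} (h : ¬ Set.InjOn p F) :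
    wedgeMap K p (Finsupp.single F 1) = 0 := by
  have hlt : (F.image p).card < F.card :=
    lt_of_le_of_ne Finset.card_image_le fun he => h (Finset.card_image_iff.mp he)
  have hmem := wedgeMap_single_mem (K := K) p F
  rw [subsetChains, show {G : Finset ℕ | G ⊆ F.image p ∧ G.card = F.card} = ∅ from
    Set.eq_empty_of_forall_notMem fun G hG =>
      (Finset.card_le_card hG.1).not_gt (hG.2.symm ▸ hlt)] at hmem
  simpa using hmem

lemma prism_single_mem (p : ℕ → ℕ) (F : Finset ℕ) :
    prism K p (Finsupp.single F 1) ∈ subsetChains K (F ∪ F.image p) (F.card + 1) := by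
  induction F using Finset.induction_on_min with
  | empty => rw [prism_single_empty]; exact zero_mem _
  | insert v F hv ih =>
    have hvF : v ∉ F := fun h => lt_irrefl _ (hv v h)
    rw [prism_single_insert _ hv, Finset.card_insert_of_notMem hvF]
    refine subsetChains_mono (F := insert (p v) (insert v F ∪ F.image p)) ?_ _
      (wedgeVec_mem_subsetChains _ (sub_mem ?_ ?_))
    · intro x; simp only [Finset.mem_insert, Finset.mem_union, Finset.mem_image]; grind
    · rw [← Finset.card_insert_of_notMem hvF]
      exact subsetChains_mono Finset.subset_union_left _ (single_mem_subsetChains _)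
    · exact subsetChains_mono (Finset.union_subset_union_left (Finset.subset_insert _ _)) _ ih

/-- An injective vertex map sends a face to its image, up to the sign counting inversions. -/
lemma wedgeMap_single_of_injOn {p : ℕ → ℕ} {F : Finset ℕ} (h : Set.InjOn p F) :
    wedgeMap K p (Finsupp.single F 1) =
      (-1 : K) ^ ((F ×ˢ F).filter fun uv => uv.1 < uv.2 ∧ p uv.2 < p uv.1).card •
        Finsupp.single (F.image p) 1 := by
  induction F using Finset.induction_on_min with
  | empty => simp [wedgeMap_single_empty]
  | insert v F hv ih =>
    have hvF : v ∉ F := fun h => lt_irrefl _ (hv v h)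
    have hpv : p v ∉ F.image p := by
      rw [Finset.mem_image]
      rintro ⟨u, hu, he⟩
      exact hvF (h (by simp [hu]) (by simp) he ▸ hu)
    rw [wedgeMap_single_insert _ hv, ih (h.mono (by simp)), map_smul, wedgeVec_single, if_neg hpv,
      smul_smul, Finset.image_insert]
    congr 1
    have hsplit : ((insert v F ×ˢ insert v F).filter fun uv => uv.1 < uv.2 ∧ p uv.2 < p uv.1) =
        ((F ×ˢ F).filter fun uv => uv.1 < uv.2 ∧ p uv.2 < p uv.1) ∪
          (F.filter fun u => p u < p v).image (Prod.mk v) := by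
      ext ⟨a, b⟩
      simp only [Finset.mem_filter, Finset.mem_product, Finset.mem_insert, Finset.mem_union,
        Finset.mem_image, Prod.mk.injEq]
      grind
    have hdisj : Disjoint ((F ×ˢ F).filter fun uv => uv.1 < uv.2 ∧ p uv.2 < p uv.1)
        ((F.filter fun u => p u < p v).image (Prod.mk v)) := by
      rw [Finset.disjoint_left]
      rintro ⟨a, b⟩
      simp only [Finset.mem_filter, Finset.mem_product, Finset.mem_image, Prod.mk.injEq]
      grind
    have hcard : ((F.image p).filter fun u => u < p v).card =
        (F.filter fun u => p u < p v).card := by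
      rw [Finset.filter_image]
      exact Finset.card_image_of_injOn (h.mono fun x hx => by
        simp only [Finset.coe_filter, Set.mem_ofPred_eq] at hx; simp [hx.1])
    rw [hsplit, Finset.card_union_of_disjoint hdisj,
      Finset.card_image_of_injective _ (Prod.mk_right_injective v), pow_add, posSign, hcard]

end Exterior

/-! ## Labeled chains -/

section LabeledChains

variable (K : Type) [Field K] {α β γ : Type}

/-- The linear map on labeled chains moving labels by `t` and acting by `φ a` on faces with
label `a`. -/
def labelMap (t : α → β) (φ : α → (Finset ℕ →₀ K) →ₗ[K] (Finset ℕ →₀ K)) :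
    (α × Finset ℕ →₀ K) →ₗ[K] (β × Finset ℕ →₀ K) :=
  Finsupp.linearCombination K fun q =>
    Finsupp.lmapDomain K K (Prod.mk (t q.1)) (φ q.1 (Finsupp.single q.2 1))

/-- The boundary of labeled chains. -/
def labelBd : (α × Finset ℕ →₀ K) →ₗ[K] (α × Finset ℕ →₀ K) :=
  labelMap K id fun _ => contr K

/-- The chains of degree `j` supported on a labeled complex. -/
abbrev chainSpace (S : Set (α × Finset ℕ)) (j : ℕ) : Submodule K (α × Finset ℕ →₀ K) :=
  Finsupp.supported K K {q | q ∈ S ∧ q.2.card = j}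

/-- Extension by zero of the chains of a labeled complex. -/
def chainIncl (S : Set (α × Finset ℕ)) (j : ℕ) :
    (ChainIdx S j →₀ K) →ₗ[K] (α × Finset ℕ →₀ K) :=
  Finsupp.lmapDomain K K fun q => q.1

variable {K}

lemma labelMap_mk (t : α → β) (φ : α → (Finset ℕ →₀ K) →ₗ[K] (Finset ℕ →₀ K)) (a : α)
    (x : Finset ℕ →₀ K) :
    labelMap K t φ (Finsupp.lmapDomain K K (Prod.mk a) x) =
      Finsupp.lmapDomain K K (Prod.mk (t a)) (φ a x) := by
  suffices h : labelMap K t φ ∘ₗ Finsupp.lmapDomain K K (Prod.mk a) =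
      Finsupp.lmapDomain K K (Prod.mk (t a)) ∘ₗ φ a from LinearMap.congr_fun h x
  ext1 F
  ext1
  simp [labelMap]

lemma labelMap_single (t : α → β) (φ : α → (Finset ℕ →₀ K) →ₗ[K] (Finset ℕ →₀ K)) (a : α)
    (F : Finset ℕ) :
    labelMap K t φ (Finsupp.single (a, F) 1) =
      Finsupp.lmapDomain K K (Prod.mk (t a)) (φ a (Finsupp.single F 1)) := by
  simp [labelMap]

lemma labelMap_comp (t : α → β) (t' : β → γ)
    (φ : α → (Finset ℕ →₀ K) →ₗ[K] (Finset ℕ →₀ K))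
    (φ' : β → (Finset ℕ →₀ K) →ₗ[K] (Finset ℕ →₀ K)) :
    labelMap K t' φ' ∘ₗ labelMap K t φ = labelMap K (t' ∘ t) fun a => φ' (t a) ∘ₗ φ a := by
  ext1 ⟨a, F⟩
  ext1
  simp only [LinearMap.coe_comp, Function.comp_apply, Finsupp.lsingle_apply, labelMap_single,
    labelMap_mk]

lemma labelBd_labelMap (t : α → β) (φ : α → (Finset ℕ →₀ K) →ₗ[K] (Finset ℕ →₀ K))
    (hφ : ∀ a x, contr K (φ a x) = φ a (contr K x)) (x : α × Finset ℕ →₀ K) :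
    labelBd K (labelMap K t φ x) = labelMap K t φ (labelBd K x) := by
  suffices h : labelBd K ∘ₗ labelMap K t φ = labelMap K t φ ∘ₗ labelBd K from
    LinearMap.congr_fun h x
  rw [labelBd, labelBd, labelMap_comp, labelMap_comp]
  congr 1
  ext1 a
  exact LinearMap.ext fun x => hφ a x

lemma labelMap_add (t : α → β) (φ ψ : α → (Finset ℕ →₀ K) →ₗ[K] (Finset ℕ →₀ K)) :
    labelMap K t (fun a => φ a + ψ a) = labelMap K t φ + labelMap K t ψ := by
  ext1 ⟨a, F⟩
  ext1
  simp only [LinearMap.coe_comp, Function.comp_apply, Finsupp.lsingle_apply, labelMap_single,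
    LinearMap.add_apply, map_add]

lemma labelMap_id : labelMap K (id : α → α) (fun _ => LinearMap.id) = LinearMap.id := by
  ext1 ⟨a, F⟩
  ext1
  simp [labelMap_single]

lemma mapsTo_chainSpace {S : Set (α × Finset ℕ)} {S' : Set (β × Finset ℕ)} {j j' : ℕ}
    {f : (α × Finset ℕ →₀ K) →ₗ[K] (β × Finset ℕ →₀ K)}
    (h : ∀ a F, (a, F) ∈ S → F.card = j → f (Finsupp.single (a, F) 1) ∈ chainSpace K S' j')
    {x : α × Finset ℕ →₀ K} (hx : x ∈ chainSpace K S j) : f x ∈ chainSpace K S' j' := by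
  revert x
  change chainSpace K S j ≤ (chainSpace K S' j').comap f
  rw [chainSpace, Finsupp.supported_eq_span_single, Submodule.span_le]
  rintro _ ⟨⟨a, F⟩, ⟨hS, hj⟩, rfl⟩
  exact h a F hS hj

lemma eqOn_chainSpace {S : Set (α × Finset ℕ)} {j : ℕ}
    {f g : (α × Finset ℕ →₀ K) →ₗ[K] (β × Finset ℕ →₀ K)}
    (h : ∀ a F, (a, F) ∈ S → f (Finsupp.single (a, F) 1) = g (Finsupp.single (a, F) 1))
    {x : α × Finset ℕ →₀ K} (hx : x ∈ chainSpace K S j) : f x = g x := by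
  revert x
  change chainSpace K S j ≤ LinearMap.eqLocus f g
  rw [chainSpace, Finsupp.supported_eq_span_single, Submodule.span_le]
  rintro _ ⟨⟨a, F⟩, ⟨hS, hj⟩, rfl⟩
  exact h a F hS

lemma lmapDomain_mk_mem_chainSpace {S : Set (α × Finset ℕ)} {a : α} {F : Finset ℕ} {j : ℕ}
    (h : ∀ G ⊆ F, (a, G) ∈ S) {x : Finset ℕ →₀ K} (hx : x ∈ subsetChains K F j) :
    Finsupp.lmapDomain K K (Prod.mk a) x ∈ chainSpace K S j := by
  have := Submodule.mem_map_of_mem (f := Finsupp.lmapDomain K K (Prod.mk a)) hx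
  rw [Finsupp.lmapDomain_supported] at this
  refine Finsupp.supported_mono ?_ this
  rintro _ ⟨G, ⟨hG, hc⟩, rfl⟩
  exact ⟨h G hG, hc⟩

lemma chainIncl_injective (S : Set (α × Finset ℕ)) (j : ℕ) :
    Function.Injective (chainIncl K S j) :=
  Finsupp.mapDomain_injective Subtype.val_injective

lemma chainIncl_single {S : Set (α × Finset ℕ)} {j : ℕ} (q : ChainIdx S j) (c : K) :
    chainIncl K S j (Finsupp.single q c) = Finsupp.single q.1 c := by
  simp [chainIncl]

lemma chainIncl_dite {S : Set (α × Finset ℕ)} {j : ℕ} {a : α} {F : Finset ℕ}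
    (h : (a, F) ∈ S ∧ F.card = j) (c : K) :
    chainIncl K S j (if h : (a, F) ∈ S ∧ F.card = j then
      c • Finsupp.single (⟨(a, F), h⟩ : ChainIdx S j) (1 : K) else 0) =
        c • Finsupp.single (a, F) 1 := by
  refine (congrArg _ (dif_pos h)).trans ((map_smul _ _ _).trans ?_)
  exact congrArg _ (chainIncl_single _ _)

lemma range_chainIncl (S : Set (α × Finset ℕ)) (j : ℕ) :
    LinearMap.range (chainIncl K S j) = chainSpace K S j := by
  rw [chainIncl, LinearMap.range_eq_map, ← Finsupp.supported_univ, Finsupp.lmapDomain_supported,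
    Set.image_univ]
  exact congrArg _ Subtype.range_coe

lemma labelBd_chainIncl {S : Set (α × Finset ℕ)}
    (hS : ∀ a F, (a, F) ∈ S → ∀ v ∈ F, (a, F.erase v) ∈ S) (j : ℕ) (x : ChainIdx S (j + 1) →₀ K) :
    labelBd K (chainIncl K S (j + 1) x) = -chainIncl K S j (bd K S j x) := by
  suffices h : labelBd K ∘ₗ chainIncl K S (j + 1) = -(chainIncl K S j ∘ₗ bd K S j) from
    LinearMap.congr_fun h x
  refine Finsupp.lhom_ext' fun q => LinearMap.ext_ring ?_
  have hc := q.2.2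
  simp only [LinearMap.coe_comp, Function.comp_apply, Finsupp.lsingle_apply, LinearMap.neg_apply,
    chainIncl_single]
  rw [← Prod.mk.eta (p := q.1)]
  simp only [labelBd, labelMap_single, bd, Finsupp.linearCombination_single, one_smul,
    bdElt, contr_single, map_sum, ← Finset.sum_neg_distrib]
  refine Finset.sum_congr rfl fun v hv => ?_
  have he : (q.1.1, q.1.2.erase v) ∈ S ∧ (q.1.2.erase v).card = j :=
    ⟨hS _ _ q.2.1 v hv, by rw [Finset.card_erase_of_mem hv]; omega⟩
  refine Eq.trans ?_ (congrArg Neg.neg (chainIncl_dite he _)).symm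
  rw [map_smul, posSign, ← neg_smul]
  have hle : q.1.2.filter (fun u => u ≤ v) = insert v (q.1.2.filter fun u => u < v) := by
    ext u; simp only [Finset.mem_filter, Finset.mem_insert]; grind
  rw [hle, Finset.card_insert_of_notMem (by simp), pow_succ]
  simp

lemma map_chainIncl_range_bd {S : Set (α × Finset ℕ)}
    (hS : ∀ a F, (a, F) ∈ S → ∀ v ∈ F, (a, F.erase v) ∈ S) (j : ℕ) :
    (LinearMap.range (bd K S j)).map (chainIncl K S j) =
      (chainSpace K S (j + 1)).map (labelBd K) := by
  rw [← range_chainIncl, ← LinearMap.range_comp, ← LinearMap.range_comp]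
  have : labelBd K ∘ₗ chainIncl K S (j + 1) = -(chainIncl K S j ∘ₗ bd K S j) :=
    LinearMap.ext (labelBd_chainIncl hS j)
  rw [this, LinearMap.range_neg]

lemma map_chainIncl_cycles {S : Set (α × Finset ℕ)}
    (hS : ∀ a F, (a, F) ∈ S → ∀ v ∈ F, (a, F.erase v) ∈ S) (j : ℕ) :
    (cycles K S j).map (chainIncl K S j) = chainSpace K S j ⊓ LinearMap.ker (labelBd K) := by
  rw [← range_chainIncl, ← Submodule.map_comap_eq, LinearMap.ker, ← Submodule.comap_comp]
  congr 1
  cases j with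
  | zero =>
    symm
    rw [cycles, eq_top_iff]
    intro x _
    change labelBd K (chainIncl K S 0 x) = 0
    refine eqOn_chainSpace (f := labelBd K) (g := 0) (S := {q | q.2.card = 0}) (j := 0) ?_
      (Finsupp.supported_mono (s := {q | q ∈ S ∧ q.2.card = 0})
        (t := {q | q.2.card = 0 ∧ q.2.card = 0})
        (fun q hq => ⟨hq.2, hq.2⟩)
        ((range_chainIncl (K := K) S 0).le
        (LinearMap.mem_range_self (chainIncl K S 0) x)))
    intro a F hF
    rw [Finset.card_eq_zero.mp (show F.card = 0 from hF), labelBd, labelMap_single,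
      contr_single_empty]
    simp
  | succ j =>
    ext x
    change bd K S j x = 0 ↔ labelBd K (chainIncl K S (j + 1) x) = 0
    rw [labelBd_chainIncl hS, neg_eq_zero, map_eq_zero_iff _ (chainIncl_injective S j)]

lemma finrank_map_chainIncl {S : Set (α × Finset ℕ)} {j : ℕ}
    (Z : Submodule K (ChainIdx S j →₀ K)) :
    Module.finrank K (Z.map (chainIncl K S j)) = Module.finrank K Z :=
  (Submodule.equivMapOfInjective _ (chainIncl_injective S j) Z).finrank_eq.symm

/-- Comparison of two subquotients through a map inducing an isomorphism between them. -/
lemma finrank_sub_finrank_inf_eq {V W : Type} [AddCommGroup V] [Module K V] [AddCommGroup W]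
    [Module K W] {Z B : Submodule K V} {Z' B' : Submodule K W} [FiniteDimensional K Z]
    [FiniteDimensional K Z'] (g : V →ₗ[K] W) (hZ : ∀ z ∈ Z, g z ∈ Z')
    (hB : ∀ z ∈ Z, z ∈ B → g z ∈ B') (hinj : ∀ z ∈ Z, g z ∈ B' → z ∈ B)
    (hsurj : ∀ z ∈ Z', ∃ y ∈ Z, g y - z ∈ B') :
    Module.finrank K Z - Module.finrank K (B ⊓ Z : Submodule K V) =
      Module.finrank K Z' - Module.finrank K (B' ⊓ Z' : Submodule K W) := by
  have hrank : ∀ {V : Type} [AddCommGroup V] [Module K V] (Z B : Submodule K V)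
      [FiniteDimensional K Z], Module.finrank K Z - Module.finrank K (B ⊓ Z : Submodule K V) =
        Module.finrank K (Z ⧸ B.comap Z.subtype) := by
    intro V _ _ Z B _
    rw [← (B.comap Z.subtype).finrank_quotient_add_finrank, inf_comm, ← Submodule.map_comap_subtype,
      Submodule.finrank_map_subtype_eq, Nat.add_sub_cancel]
  rw [hrank, hrank]
  let f : Z →ₗ[K] Z' ⧸ B'.comap Z'.subtype := (B'.comap Z'.subtype).mkQ ∘ₗ g.restrict hZ
  have hker : LinearMap.ker f = B.comap Z.subtype := by
    ext ⟨z, hz⟩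
    simp only [f, LinearMap.mem_ker, LinearMap.comp_apply, Submodule.mkQ_apply,
      Submodule.Quotient.mk_eq_zero, Submodule.mem_comap, Submodule.subtype_apply,
      LinearMap.coe_restrict_apply]
    exact ⟨hinj z hz, hB z hz⟩
  have hf : Function.Surjective f := by
    intro y
    obtain ⟨⟨z, hz⟩, rfl⟩ := Submodule.mkQ_surjective _ y
    obtain ⟨y, hy, hyz⟩ := hsurj z hz
    exact ⟨⟨y, hy⟩, (Submodule.Quotient.eq _).mpr hyz⟩
  rw [← hker]
  exact (f.quotKerEquivOfSurjective hf).finrank_eq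

end LabeledChains

/-! ## Monomial membership and last positions in blocks of equal entries -/

section Combinatorics

variable {K : Type} [Field K] {n r : ℕ}

lemma mon_mem_span_mon {ι : Type} (f : ι → Fin n → ℕ) (b : Fin n → ℕ) :
    mon K n b ∈ Ideal.span (Set.range fun i => mon K n (f i)) ↔ ∃ i, f i ≤ b := by
  have h : (Set.range fun i => mon K n (f i)) =
      (fun s => MvPolynomial.monomial s (1 : K)) ''
        Set.range fun i => Finsupp.equivFunOnFinite.symm (f i) := by
    rw [← Set.range_comp]; rfl
  rw [h, MvPolynomial.mem_ideal_span_monomial_image, mon, MvPolynomial.support_monomial,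
    if_neg one_ne_zero]
  simp only [Finset.mem_singleton, forall_eq, Set.exists_range_iff]
  rfl

lemma mon_mem_unsymIdeal (L : Fin r → Fin n → ℕ) (b : Fin n → ℕ) :
    mon K n b ∈ unsymIdeal K n r L ↔ ∃ j, L j ≤ b := by
  rw [← mon_mem_span_mon (K := K), unsymIdeal]
  congr! 3
  ext f
  simp [eq_comm]

lemma mon_mem_symIdeal (L : Fin r → Fin n → ℕ) (b : Fin n → ℕ) :
    mon K n b ∈ symIdeal K n r L ↔
      ∃ (j : Fin r) (σ : Equiv.Perm (Fin n)), ∀ i, L j i ≤ b (σ i) := by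
  have h := mon_mem_span_mon (K := K)
    (fun q : Fin r × Equiv.Perm (Fin n) => L q.1 ∘ ⇑q.2⁻¹) b
  have hmon : ∀ (j : Fin r) (σ : Equiv.Perm (Fin n)),
      MvPolynomial.rename σ (mon K n (L j)) = mon K n (L j ∘ ⇑σ⁻¹) := by
    intro j σ
    rw [mon, MvPolynomial.rename_monomial, mon]
    congr 2
    ext i
    rw [← Finsupp.equivMapDomain_eq_mapDomain]
    rfl
  rw [symIdeal, show {f | ∃ (j : Fin r) (σ : Equiv.Perm (Fin n)),
      f = MvPolynomial.rename σ (mon K n (L j))} =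
        Set.range fun q : Fin r × Equiv.Perm (Fin n) => mon K n (L q.1 ∘ ⇑q.2⁻¹) by
    ext f; simp [hmon, eq_comm], h]
  constructor
  · rintro ⟨⟨j, σ⟩, hσ⟩
    exact ⟨j, σ, fun i => by simpa using hσ (σ i)⟩
  · rintro ⟨j, σ, hσ⟩
    exact ⟨⟨j, σ⟩, fun i => by simpa using hσ (σ⁻¹ i)⟩

/-- If some rearrangement of a weakly decreasing sequence is bounded by a weakly decreasing
sequence, then so is the sequence itself. -/
lemma le_of_antitone_of_perm_le {f b : Fin n → ℕ} (hf : Antitone f) (hb : Antitone b)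
    (σ : Equiv.Perm (Fin n)) (h : ∀ i, f i ≤ b (σ i)) : f ≤ b := by
  intro i
  obtain ⟨k, hk, hik⟩ : ∃ k ≤ i, i ≤ σ k := by
    by_contra! hcon
    have hsub : (Finset.Iic i).image σ ⊆ Finset.Iio i := by
      intro x hx
      obtain ⟨k, hk, rfl⟩ := Finset.mem_image.mp hx
      exact Finset.mem_Iio.mpr (hcon k (Finset.mem_Iic.mp hk))
    have hcard := Finset.card_le_card hsub
    rw [Finset.card_image_of_injective _ σ.injective] at hcard
    simp at hcard
  exact (hf hk).trans ((h k).trans (hb hik))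

/-- The last position at which `μ` takes the value `c`. -/
def lastPos (μ : Fin n → ℕ) (c : ℕ) : ℕ :=
  (Finset.univ.filter fun i => μ i = c).sup fun i => (i : ℕ)

lemma exists_lastPos (μ : Fin n → ℕ) (i : Fin n) :
    ∃ k : Fin n, lastPos μ (μ i) = k ∧ μ k = μ i ∧ ∀ l, μ l = μ i → l ≤ k := by
  obtain ⟨k, hk, he⟩ := Finset.exists_mem_eq_sup (Finset.univ.filter fun l => μ l = μ i)
    ⟨i, by simp⟩ fun i => (i : ℕ)
  refine ⟨k, he, by simpa using hk, fun l hl => ?_⟩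
  have : (l : ℕ) ≤ lastPos μ (μ i) :=
    Finset.le_sup (f := fun i : Fin n => (i : ℕ)) (by simpa using hl)
  rw [lastPos, he] at this
  exact this

/-- The map sending a position `v` of a rearrangement `a` of `μ` to the last position of the
corresponding block of `μ`. -/
def blockEnd (μ a : Fin n → ℕ) (v : ℕ) : ℕ :=
  if h : v < n then lastPos μ (a ⟨v, h⟩) else v

lemma blockEnd_val (μ a : Fin n → ℕ) (i : Fin n) : blockEnd μ a i = lastPos μ (a i) := by
  simp [blockEnd]

lemma permNat_val (σ : Equiv.Perm (Fin n)) (i : Fin n) : permNat n σ i = σ i := by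
  simp [permNat]

lemma permNat_of_le (σ : Equiv.Perm (Fin n)) {v : ℕ} (h : n ≤ v) : permNat n σ v = v := by
  simp [permNat, h.not_gt]

lemma permNat_mul (σ τ : Equiv.Perm (Fin n)) : permNat n (σ * τ) = permNat n σ ∘ permNat n τ := by
  ext v
  rcases lt_or_ge v n with h | h
  · lift v to Fin n using h
    simp [permNat_val]
  · simp [permNat_of_le _ h]

lemma permNat_one : permNat n 1 = id := by
  ext v
  simp [permNat]

lemma permNat_injective (σ : Equiv.Perm (Fin n)) : Function.Injective (permNat n σ) := by
  refine Function.LeftInverse.injective (g := permNat n σ⁻¹) fun v => ?_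
  rw [← Function.comp_apply (f := permNat n σ⁻¹), ← permNat_mul, inv_mul_cancel, permNat_one, id]

lemma blockEnd_comp_permNat (μ a : Fin n → ℕ) (σ : Equiv.Perm (Fin n)) :
    blockEnd μ (a ∘ ⇑σ⁻¹) ∘ permNat n σ = blockEnd μ a := by
  ext v
  rcases lt_or_ge v n with h | h
  · lift v to Fin n using h
    simp [permNat_val, blockEnd_val]
  · simp [permNat_of_le _ h, blockEnd, h.not_gt]

/-- On a set meeting each block at most once, the map to block ends extends to a permutation
sorting the sequence. -/
lemma exists_perm_eq_blockEnd {μ a : Fin n → ℕ} (ha : ∃ σ : Equiv.Perm (Fin n), a = μ ∘ σ)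
    {F : Finset ℕ} (hF : F ⊆ Finset.range n) (hinj : Set.InjOn (blockEnd μ a) F) :
    ∃ σ : Equiv.Perm (Fin n), a = μ ∘ σ ∧ ∀ v ∈ F, permNat n σ v = blockEnd μ a v := by
  induction F using Finset.induction_on with
  | empty => simpa using ha
  | insert v F hv ih =>
    obtain ⟨σ, hσ, hσF⟩ := ih (fun x hx => hF (by simp [hx])) (hinj.mono (by simp))
    have hvn : v < n := by simpa using hF (Finset.mem_insert_self v F)
    lift v to Fin n using hvn
    obtain ⟨k, hk, hμk, -⟩ := exists_lastPos μ (σ v)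
    have hak : blockEnd μ a v = k := by rw [blockEnd_val, hσ, Function.comp_apply, hk]
    refine ⟨Equiv.swap (σ v) k * σ, ?_, ?_⟩
    · rw [hσ]
      ext i
      rw [Function.comp_apply, Function.comp_apply, Equiv.Perm.mul_apply, Equiv.swap_apply_def]
      split_ifs with h1 h2
      · rw [h1, hμk]
      · rw [h2, hμk]
      · rfl
    · intro u hu
      rw [Finset.mem_insert] at hu
      rcases hu with rfl | hu
      · rw [hak, permNat_val]; simp
      · have hun : u < n := by simpa using hF (Finset.mem_insert_of_mem hu)
        lift u to Fin n using hun
        have huv : (u : ℕ) ≠ v := fun h => hv (h ▸ hu)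
        have h1 : σ u ≠ k := fun h => huv (hinj (by simp [hu]) (by simp) (by
          rw [hak, ← hσF u hu, permNat_val, h]))
        have h2 : σ u ≠ σ v := fun h => huv (congrArg Fin.val (σ.injective h))
        rw [← hσF u hu, permNat_val, permNat_val, Equiv.Perm.mul_apply,
          Equiv.swap_apply_of_ne_of_ne h2 h1]

lemma eF_le_of_subset {F G : Finset ℕ} (h : G ⊆ F) (v : ℕ) : eF G v ≤ eF F v := by
  unfold eF
  split_ifs with h1 h2
  · rfl
  · exact absurd (h h1) h2
  all_goals simp

variable (L : Fin r → Fin n → ℕ) (μ : Fin n → ℕ)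

lemma mem_KosI_unsymIdeal {F : Finset ℕ} :
    F ∈ KosI K n (unsymIdeal K n r L) μ ↔ F ⊆ Finset.range n ∧
      (∀ i : Fin n, (i : ℕ) ∈ F → 1 ≤ μ i) ∧ ∃ j, ∀ i, L j i ≤ μ i - eF F i := by
  rw [KosI, Set.mem_ofPred_eq, mon_mem_unsymIdeal]
  rfl

lemma mem_KosSym_symIdeal {a : Fin n → ℕ} {F : Finset ℕ} :
    (a, F) ∈ KosSym K n (symIdeal K n r L) μ ↔ (∃ σ : Equiv.Perm (Fin n), a = μ ∘ σ) ∧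
      F ⊆ Finset.range n ∧ (∀ i : Fin n, (i : ℕ) ∈ F → 1 ≤ a i) ∧
        ∃ (j : Fin r) (σ : Equiv.Perm (Fin n)), ∀ i, L j i ≤ a (σ i) - eF F (σ i) := by
  rw [KosSym, Set.mem_ofPred_eq, mon_mem_symIdeal]

variable {L μ}

lemma KosI_mono {F G : Finset ℕ} (hF : F ∈ KosI K n (unsymIdeal K n r L) μ) (h : G ⊆ F) :
    G ∈ KosI K n (unsymIdeal K n r L) μ := by
  rw [mem_KosI_unsymIdeal] at hF ⊢
  obtain ⟨h1, h2, j, h3⟩ := hF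
  exact ⟨h.trans h1, fun i hi => h2 i (h hi), j, fun i =>
    (h3 i).trans (Nat.sub_le_sub_left (eF_le_of_subset h _) _)⟩

lemma KosSym_mono {a : Fin n → ℕ} {F G : Finset ℕ}
    (hF : (a, F) ∈ KosSym K n (symIdeal K n r L) μ) (h : G ⊆ F) :
    (a, G) ∈ KosSym K n (symIdeal K n r L) μ := by
  rw [mem_KosSym_symIdeal] at hF ⊢
  obtain ⟨h0, h1, h2, j, σ, h3⟩ := hF
  exact ⟨h0, h.trans h1, fun i hi => h2 i (h hi), j, σ, fun i =>
    (h3 i).trans (Nat.sub_le_sub_left (eF_le_of_subset h _) _)⟩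

lemma mk_mem_KosSym {F : Finset ℕ} (hF : F ∈ KosI K n (unsymIdeal K n r L) μ) :
    (μ, F) ∈ KosSym K n (symIdeal K n r L) μ := by
  rw [mem_KosI_unsymIdeal] at hF
  rw [mem_KosSym_symIdeal]
  obtain ⟨h1, h2, j, h3⟩ := hF
  exact ⟨⟨1, rfl⟩, h1, h2, j, 1, h3⟩

lemma permFinset_mem_iff (σ : Equiv.Perm (Fin n)) (F : Finset ℕ) (i : Fin n) :
    (i : ℕ) ∈ permFinset n σ F ↔ (σ⁻¹ i : ℕ) ∈ F := by
  have h : permNat n σ (σ⁻¹ i : ℕ) = i := by simp [permNat_val]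
  conv_lhs => rw [← h, permFinset, (permNat_injective σ).mem_finset_image]

lemma permFinset_subset_range (σ : Equiv.Perm (Fin n)) {F : Finset ℕ} (h : F ⊆ Finset.range n) :
    permFinset n σ F ⊆ Finset.range n := by
  intro x hx
  obtain ⟨v, hv, rfl⟩ := Finset.mem_image.mp hx
  have hvn : v < n := by simpa using h hv
  lift v to Fin n using hvn
  simp [permNat_val]

lemma eF_permFinset (σ : Equiv.Perm (Fin n)) (F : Finset ℕ) (i : Fin n) :
    eF (permFinset n σ F) (σ i) = eF F i := by
  simp [eF, permFinset_mem_iff]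

lemma perm_mem_KosSym {a : Fin n → ℕ} {F : Finset ℕ}
    (hF : (a, F) ∈ KosSym K n (symIdeal K n r L) μ) (τ : Equiv.Perm (Fin n)) :
    (a ∘ ⇑τ⁻¹, permFinset n τ F) ∈ KosSym K n (symIdeal K n r L) μ := by
  rw [mem_KosSym_symIdeal] at hF ⊢
  obtain ⟨⟨ρ, rfl⟩, h1, h2, j, σ, h3⟩ := hF
  refine ⟨⟨ρ * τ⁻¹, rfl⟩, permFinset_subset_range τ h1, fun i hi => ?_, j, τ * σ, fun i => ?_⟩
  · exact h2 _ ((permFinset_mem_iff _ _ _).mp hi)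
  · simpa [eF_permFinset] using h3 i

/-- Adding the ends of the blocks met by a face of the Koszul complex gives a face. -/
lemma union_blockEnd_mem_KosI (hL : ∀ j, Antitone (L j)) {F : Finset ℕ}
    (hF : F ∈ KosI K n (unsymIdeal K n r L) μ) :
    F ∪ F.image (blockEnd μ μ) ∈ KosI K n (unsymIdeal K n r L) μ := by
  rw [mem_KosI_unsymIdeal] at hF ⊢
  obtain ⟨h1, h2, j, h3⟩ := hF
  have key : ∀ v ∈ F, ∃ i k : Fin n,
      (i : ℕ) = v ∧ (k : ℕ) = blockEnd μ μ v ∧ μ k = μ i ∧ i ≤ k := by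
    intro v hv
    have hvn : v < n := by simpa using h1 hv
    lift v to Fin n using hvn
    obtain ⟨k, hk, hμk, hmax⟩ := exists_lastPos μ v
    exact ⟨v, k, rfl, by rw [blockEnd_val, hk], hμk, hmax v rfl⟩
  refine ⟨Finset.union_subset h1 ?_, ?_, j, ?_⟩
  · intro x hx
    obtain ⟨v, hv, rfl⟩ := Finset.mem_image.mp hx
    obtain ⟨i, k, -, hk, -⟩ := key v hv
    rw [← hk]; simp
  · intro i hi
    rcases Finset.mem_union.mp hi with hi | hi
    · exact h2 i hi
    · obtain ⟨v, hv, he⟩ := Finset.mem_image.mp hi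
      obtain ⟨i', k, rfl, hk, hμ, -⟩ := key v hv
      obtain rfl : k = i := Fin.ext (hk.trans he)
      rw [hμ]; exact h2 i' hv
  · intro i
    by_cases hi : (i : ℕ) ∈ F.image (blockEnd μ μ)
    · obtain ⟨v, hv, he⟩ := Finset.mem_image.mp hi
      obtain ⟨i', k, rfl, hk, hμ, hle⟩ := key v hv
      obtain rfl : k = i := Fin.ext (hk.trans he)
      have h4 := h3 i'
      have h5 := hL j hle
      simp only [eF, hv, if_true] at h4
      simp only [eF, Finset.mem_union_right F hi, if_true]
      omega
    · have : eF (F ∪ F.image (blockEnd μ μ)) i = eF F i := by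
        simp only [eF, Finset.mem_union, hi, or_false]
      rw [this]; exact h3 i

/-- A face of the symmetrized complex meeting each block at most once yields a face of the
Koszul complex of the unsymmetrization, consisting of block ends. -/
lemma image_blockEnd_mem_KosI (hL : ∀ j, Antitone (L j)) (hμ : Antitone μ) {a : Fin n → ℕ}
    {F : Finset ℕ} (hF : (a, F) ∈ KosSym K n (symIdeal K n r L) μ)
    (hinj : Set.InjOn (blockEnd μ a) F) :
    F.image (blockEnd μ a) ∈ KosI K n (unsymIdeal K n r L) μ := by
  have hF' := (mem_KosSym_symIdeal L μ).mp hF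
  obtain ⟨σ, hσ, hσF⟩ := exists_perm_eq_blockEnd hF'.1 hF'.2.1 hinj
  have himg : F.image (blockEnd μ a) = permFinset n σ F :=
    Finset.image_congr fun v hv => (hσF v hv).symm
  have haσ : a ∘ ⇑σ⁻¹ = μ := by ext i; simp [hσ]
  have hG := perm_mem_KosSym hF σ
  rw [haσ, ← himg, mem_KosSym_symIdeal] at hG
  obtain ⟨-, h1, h2, j, τ, h3⟩ := hG
  rw [mem_KosI_unsymIdeal]
  refine ⟨h1, h2, j, le_of_antitone_of_perm_le (hL j) ?_ τ h3⟩
  intro i k hik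
  have hle := hμ hik
  by_cases hi : (i : ℕ) ∈ F.image (blockEnd μ a)
  · by_cases hk : (k : ℕ) ∈ F.image (blockEnd μ a)
    · simp only [eF, hi, hk, if_true]; omega
    · rcases hle.lt_or_eq with hlt | heq
      · simp only [eF, hi, hk, if_true, if_false]; omega
      · obtain ⟨v, hv, he⟩ := Finset.mem_image.mp hi
        have hvn : v < n := by simpa using hF'.2.1 hv
        lift v to Fin n using hvn
        obtain ⟨l, hl, hμl, hmax⟩ := exists_lastPos μ (σ v)
        rw [blockEnd_val, hσ, Function.comp_apply, hl] at he
        obtain rfl : l = i := Fin.ext he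
        have : k = l := le_antisymm (hmax k (heq.trans hμl)) hik
        exact absurd (this ▸ hi) hk
  · have : eF (F.image (blockEnd μ a)) (i : ℕ) = 0 := by simp [eF, hi]
    dsimp only
    rw [this]
    omega

end Combinatorics

/-! ## Symmetrization -/

section Symmetrization

variable (K : Type) [Field K] {n r : ℕ}

/-- The signed action of a permutation on labeled chains. -/
def permLabelMap (σ : Equiv.Perm (Fin n)) :
    ((Fin n → ℕ) × Finset ℕ →₀ K) →ₗ[K] ((Fin n → ℕ) × Finset ℕ →₀ K) :=
  labelMap K (fun a => a ∘ ⇑σ⁻¹) fun _ => wedgeMap K (permNat n σ)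

/-- The sum of all permutations acting on labeled chains. -/
def normMap (n : ℕ) : ((Fin n → ℕ) × Finset ℕ →₀ K) →ₗ[K] ((Fin n → ℕ) × Finset ℕ →₀ K) :=
  ∑ σ : Equiv.Perm (Fin n), permLabelMap K σ

/-- The projection of the symmetrized complex to unlabeled chains on block ends of `μ`. -/
def blockEndMap (μ : Fin n → ℕ) :
    ((Fin n → ℕ) × Finset ℕ →₀ K) →ₗ[K] (Unit × Finset ℕ →₀ K) :=
  labelMap K (fun _ => ()) fun a => wedgeMap K (blockEnd μ a)

/-- The inclusion of unlabeled chains as chains with label `μ`. -/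
def withLabel (μ : Fin n → ℕ) :
    (Unit × Finset ℕ →₀ K) →ₗ[K] ((Fin n → ℕ) × Finset ℕ →₀ K) :=
  labelMap K (fun _ => μ) fun _ => LinearMap.id

variable {K}

lemma permLabelMap_comp (σ τ : Equiv.Perm (Fin n)) :
    permLabelMap K σ ∘ₗ permLabelMap K τ = permLabelMap K (σ * τ) := by
  rw [permLabelMap, permLabelMap, labelMap_comp, permLabelMap]
  congr 1
  ext1 a
  refine LinearMap.ext fun x => ?_
  rw [permNat_mul]
  exact wedgeMap_wedgeMap _ _ x

lemma permLabelMap_permLabelMap (σ τ : Equiv.Perm (Fin n)) (x : (Fin n → ℕ) × Finset ℕ →₀ K) :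
    permLabelMap K σ (permLabelMap K τ x) = permLabelMap K (σ * τ) x :=
  LinearMap.congr_fun (permLabelMap_comp σ τ) x

lemma normMap_permLabelMap (σ : Equiv.Perm (Fin n)) (x : (Fin n → ℕ) × Finset ℕ →₀ K) :
    normMap K n (permLabelMap K σ x) = normMap K n x := by
  simp only [normMap, LinearMap.sum_apply, permLabelMap_permLabelMap]
  exact Fintype.sum_equiv (Equiv.mulRight σ) _ _ fun _ => rfl

lemma permLabelMap_normMap (σ : Equiv.Perm (Fin n)) (x : (Fin n → ℕ) × Finset ℕ →₀ K) :
    permLabelMap K σ (normMap K n x) = normMap K n x := by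
  simp only [normMap, LinearMap.sum_apply, map_sum, permLabelMap_permLabelMap]
  exact Fintype.sum_equiv (Equiv.mulLeft σ) _ _ fun _ => rfl

lemma labelBd_permLabelMap (σ : Equiv.Perm (Fin n)) (x : (Fin n → ℕ) × Finset ℕ →₀ K) :
    labelBd K (permLabelMap K σ x) = permLabelMap K σ (labelBd K x) :=
  labelBd_labelMap _ _ (fun _ => contr_wedgeMap _) x

lemma labelBd_normMap (x : (Fin n → ℕ) × Finset ℕ →₀ K) :
    labelBd K (normMap K n x) = normMap K n (labelBd K x) := by
  simp [normMap, LinearMap.sum_apply, labelBd_permLabelMap]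

lemma labelBd_blockEndMap (μ : Fin n → ℕ) (x : (Fin n → ℕ) × Finset ℕ →₀ K) :
    labelBd K (blockEndMap K μ x) = blockEndMap K μ (labelBd K x) :=
  labelBd_labelMap _ _ (fun _ => contr_wedgeMap _) x

lemma labelBd_withLabel (μ : Fin n → ℕ) (x : Unit × Finset ℕ →₀ K) :
    labelBd K (withLabel K μ x) = withLabel K μ (labelBd K x) :=
  labelBd_labelMap (fun _ => μ) (fun _ => LinearMap.id)
    (fun _ y => by rw [LinearMap.id_apply, LinearMap.id_apply]) x

lemma blockEndMap_permLabelMap (μ : Fin n → ℕ) (σ : Equiv.Perm (Fin n))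
    (x : (Fin n → ℕ) × Finset ℕ →₀ K) :
    blockEndMap K μ (permLabelMap K σ x) = blockEndMap K μ x := by
  suffices h : blockEndMap K μ ∘ₗ permLabelMap K σ = blockEndMap K μ from LinearMap.congr_fun h x
  rw [blockEndMap, permLabelMap, labelMap_comp]
  congr 1
  ext1 a
  refine LinearMap.ext fun x => ?_
  rw [LinearMap.comp_apply, wedgeMap_wedgeMap, blockEnd_comp_permNat]

lemma blockEndMap_normMap (μ : Fin n → ℕ) (x : (Fin n → ℕ) × Finset ℕ →₀ K) :
    blockEndMap K μ (normMap K n x) = (n.factorial : K) • blockEndMap K μ x := by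
  simp only [normMap, LinearMap.sum_apply, map_sum, blockEndMap_permLabelMap, Finset.sum_const,
    Finset.card_univ, Fintype.card_perm, Fintype.card_fin, Nat.cast_smul_eq_nsmul]

lemma blockEndMap_withLabel (μ : Fin n → ℕ) (x : Unit × Finset ℕ →₀ K) :
    blockEndMap K μ (withLabel K μ x) =
      labelMap K id (fun _ => wedgeMap K (blockEnd μ μ)) x := by
  rw [blockEndMap, withLabel, ← LinearMap.comp_apply, labelMap_comp]
  rfl

/-- The prism operator on unlabeled chains is a homotopy from the identity to
`blockEndMap ∘ withLabel`. -/
lemma labelBd_prism_add (μ : Fin n → ℕ) (x : Unit × Finset ℕ →₀ K) :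
    labelBd K (labelMap K id (fun _ => prism K (blockEnd μ μ)) x) +
      labelMap K id (fun _ => prism K (blockEnd μ μ)) (labelBd K x) +
        blockEndMap K μ (withLabel K μ x) = x := by
  rw [blockEndMap_withLabel]
  suffices h : labelBd K ∘ₗ labelMap K id (fun _ => prism K (blockEnd μ μ)) +
      labelMap K id (fun _ => prism K (blockEnd μ μ)) ∘ₗ labelBd K +
        labelMap K id (fun _ => wedgeMap K (blockEnd μ μ)) = LinearMap.id from
    LinearMap.congr_fun h x
  rw [labelBd, labelMap_comp, labelMap_comp, Function.comp_id, ← labelMap_add, ← labelMap_add,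
    ← labelMap_id]
  congr 1
  funext a
  refine LinearMap.ext fun x => ?_
  simp only [LinearMap.add_apply, LinearMap.comp_apply, contr_prism, LinearMap.id_apply,
    sub_add_cancel]

lemma chainIncl_permAct (L : Fin r → Fin n → ℕ) (μ : Fin n → ℕ) (σ : Equiv.Perm (Fin n)) (j : ℕ)
    (x : ChainIdx (KosSym K n (symIdeal K n r L) μ) j →₀ K) :
    chainIncl K (KosSym K n (symIdeal K n r L) μ) j
        (permAct K n (KosSym K n (symIdeal K n r L) μ) σ j x) =
      permLabelMap K σ (chainIncl K (KosSym K n (symIdeal K n r L) μ) j x) := by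
  suffices h : chainIncl K (KosSym K n (symIdeal K n r L) μ) j ∘ₗ permAct K n _ σ j =
      permLabelMap K σ ∘ₗ chainIncl K (KosSym K n (symIdeal K n r L) μ) j from
    LinearMap.congr_fun h x
  refine Finsupp.lhom_ext' fun q => LinearMap.ext_ring ?_
  simp only [LinearMap.coe_comp, Function.comp_apply, Finsupp.lsingle_apply, chainIncl_single]
  rw [← Prod.mk.eta (p := q.1), permAct, Finsupp.linearCombination_single, one_smul, actElt]
  have hq : (q.1.1 ∘ ⇑σ⁻¹, permFinset n σ q.1.2) ∈ KosSym K n (symIdeal K n r L) μ ∧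
      (permFinset n σ q.1.2).card = j :=
    ⟨perm_mem_KosSym q.2.1 σ, by
      rw [permFinset, Finset.card_image_of_injective _ (permNat_injective σ)]; exact q.2.2⟩
  refine (chainIncl_dite hq _).trans ?_
  rw [permLabelMap, labelMap_single, wedgeMap_single_of_injOn (permNat_injective σ).injOn, map_smul]
  simp [permSign, permFinset]

lemma permLabelMap_mem (L : Fin r → Fin n → ℕ) (μ : Fin n → ℕ) (σ : Equiv.Perm (Fin n)) {j : ℕ}
    {x : (Fin n → ℕ) × Finset ℕ →₀ K}
    (hx : x ∈ chainSpace K (KosSym K n (symIdeal K n r L) μ) j) :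
    permLabelMap K σ x ∈ chainSpace K (KosSym K n (symIdeal K n r L) μ) j := by
  refine mapsTo_chainSpace (fun a F hF hj => ?_) hx
  subst hj
  rw [permLabelMap, labelMap_single]
  exact lmapDomain_mk_mem_chainSpace (fun G hG => KosSym_mono (perm_mem_KosSym hF σ) hG)
    (wedgeMap_single_mem _ _)

lemma normMap_mem (L : Fin r → Fin n → ℕ) (μ : Fin n → ℕ) {j : ℕ}
    {x : (Fin n → ℕ) × Finset ℕ →₀ K}
    (hx : x ∈ chainSpace K (KosSym K n (symIdeal K n r L) μ) j) :
    normMap K n x ∈ chainSpace K (KosSym K n (symIdeal K n r L) μ) j := by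
  rw [normMap, LinearMap.sum_apply]
  exact sum_mem fun σ _ => permLabelMap_mem L μ σ hx

lemma withLabel_mem (L : Fin r → Fin n → ℕ) (μ : Fin n → ℕ) {j : ℕ} {x : Unit × Finset ℕ →₀ K}
    (hx : x ∈ chainSpace K (lab (KosI K n (unsymIdeal K n r L) μ)) j) :
    withLabel K μ x ∈ chainSpace K (KosSym K n (symIdeal K n r L) μ) j := by
  refine mapsTo_chainSpace (fun a F hF hj => ?_) hx
  subst hj
  rw [withLabel, labelMap_single]
  exact lmapDomain_mk_mem_chainSpace (fun G hG => mk_mem_KosSym (KosI_mono hF hG))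
    (single_mem_subsetChains _)

lemma blockEndMap_mem {L : Fin r → Fin n → ℕ} (hL : ∀ j, Antitone (L j)) {μ : Fin n → ℕ}
    (hμ : Antitone μ) {j : ℕ} {x : (Fin n → ℕ) × Finset ℕ →₀ K}
    (hx : x ∈ chainSpace K (KosSym K n (symIdeal K n r L) μ) j) :
    blockEndMap K μ x ∈ chainSpace K (lab (KosI K n (unsymIdeal K n r L) μ)) j := by
  refine mapsTo_chainSpace (fun a F hF hj => ?_) hx
  subst hj
  rw [blockEndMap, labelMap_single]
  by_cases hinj : Set.InjOn (blockEnd μ a) F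
  · exact lmapDomain_mk_mem_chainSpace
      (fun G hG => KosI_mono (image_blockEnd_mem_KosI hL hμ hF hinj) hG) (wedgeMap_single_mem _ _)
  · rw [wedgeMap_single_of_not_injOn hinj, map_zero]
    exact zero_mem _

lemma prism_mem {L : Fin r → Fin n → ℕ} (hL : ∀ j, Antitone (L j)) (μ : Fin n → ℕ)
    {j : ℕ} {x : Unit × Finset ℕ →₀ K}
    (hx : x ∈ chainSpace K (lab (KosI K n (unsymIdeal K n r L) μ)) j) :
    labelMap K id (fun _ => prism K (blockEnd μ μ)) x ∈
      chainSpace K (lab (KosI K n (unsymIdeal K n r L) μ)) (j + 1) := by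
  refine mapsTo_chainSpace (fun a F hF hj => ?_) hx
  subst hj
  rw [labelMap_single]
  exact lmapDomain_mk_mem_chainSpace
    (fun G hG => KosI_mono (union_blockEnd_mem_KosI hL hF) hG) (prism_single_mem _ _)

/-- Symmetrization factors through the projection to block ends. -/
lemma normMap_withLabel_blockEndMap (hchar : ringChar K = 0 ∨ n < ringChar K)
    (L : Fin r → Fin n → ℕ) (μ : Fin n → ℕ) {j : ℕ} {x : (Fin n → ℕ) × Finset ℕ →₀ K}
    (hx : x ∈ chainSpace K (KosSym K n (symIdeal K n r L) μ) j) :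
    normMap K n (withLabel K μ (blockEndMap K μ x)) = normMap K n x := by
  refine eqOn_chainSpace (f := normMap K n ∘ₗ withLabel K μ ∘ₗ blockEndMap K μ) ?_ hx
  intro a F hF
  rw [mem_KosSym_symIdeal] at hF
  obtain ⟨ha, hFn, -⟩ := hF
  simp only [LinearMap.comp_apply, blockEndMap, labelMap_single, withLabel, labelMap_mk,
    LinearMap.id_apply]
  by_cases hinj : Set.InjOn (blockEnd μ a) F
  · obtain ⟨σ, hσ, hσF⟩ := exists_perm_eq_blockEnd ha hFn hinj
    have haσ : a ∘ ⇑σ⁻¹ = μ := by ext i; simp [hσ]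
    rw [← wedgeMap_congr hσF, ← normMap_permLabelMap σ (Finsupp.single (a, F) 1), permLabelMap,
      labelMap_single, haσ]
  · rw [wedgeMap_single_of_not_injOn hinj, map_zero, map_zero]
    simp only [Set.InjOn, not_forall] at hinj
    obtain ⟨u, hu, v, hv, he, huv⟩ := hinj
    have hun : u < n := by simpa using hFn hu
    have hvn : v < n := by simpa using hFn hv
    lift u to Fin n using hun
    lift v to Fin n using hvn
    have hau : a u = a v := by
      obtain ⟨σ, rfl⟩ := ha
      obtain ⟨k, hk, hμk, -⟩ := exists_lastPos μ (σ u)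
      obtain ⟨l, hl, hμl, -⟩ := exists_lastPos μ (σ v)
      rw [blockEnd_val, blockEnd_val, Function.comp_apply, Function.comp_apply, hk, hl] at he
      rw [Function.comp_apply, Function.comp_apply, ← hμk, ← hμl, Fin.ext he]
    have huv' : u ≠ v := fun h => huv (congrArg _ h)
    have hneg : permLabelMap K (Equiv.swap u v) (Finsupp.single (a, F) 1) =
        -Finsupp.single (a, F) 1 := by
      rw [permLabelMap, labelMap_single, wedgeMap_swap hu hv huv (by simp [permNat_val])
        (by simp [permNat_val])]
      · have : a ∘ ⇑(Equiv.swap u v)⁻¹ = a := by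
          ext i
          rw [Equiv.swap_inv, Function.comp_apply, Equiv.swap_apply_def]
          split_ifs with h1 h2
          · rw [h1, hau]
          · rw [h2, hau]
          · rfl
        rw [this, map_neg]
        simp
      · intro w hw hwu hwv
        have hwn : w < n := by simpa using hFn hw
        lift w to Fin n using hwn
        rw [permNat_val, Equiv.swap_apply_of_ne_of_ne (fun h => hwu (congrArg _ h))
          fun h => hwv (congrArg _ h)]
    have hself := normMap_permLabelMap (Equiv.swap u v) (Finsupp.single (a, F) (1 : K))
    rw [hneg, map_neg] at hself
    have h2 : (2 : K) ≠ 0 := by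
      refine Ring.two_ne_zero ?_
      have : 2 ≤ n := by
        have := u.2; have := v.2
        have : (u : ℕ) ≠ v := huv
        omega
      omega
    have hadd := neg_eq_iff_add_eq_zero.mp hself
    rw [← two_smul K, smul_eq_zero] at hadd
    exact (hadd.resolve_left h2).symm

lemma factorial_ne_zero_of_ringChar (hchar : ringChar K = 0 ∨ n < ringChar K) :
    (n.factorial : K) ≠ 0 := by
  intro h
  rw [ringChar.spec] at h
  rcases hchar with h0 | hlt
  · rw [h0, zero_dvd_iff] at h
    exact n.factorial_ne_zero h
  · rcases CharP.char_is_prime_or_zero K (ringChar K) with hp | h0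
    · exact hlt.not_ge ((Nat.Prime.dvd_factorial hp).mp h)
    · omega

lemma mem_map_chainIncl_invCycles (L : Fin r → Fin n → ℕ) (μ : Fin n → ℕ) (j : ℕ)
    (z : (Fin n → ℕ) × Finset ℕ →₀ K) :
    z ∈ (invCycles K n (KosSym K n (symIdeal K n r L) μ) j).map (chainIncl K _ j) ↔
      z ∈ chainSpace K (KosSym K n (symIdeal K n r L) μ) j ∧ labelBd K z = 0 ∧
        ∀ σ : Equiv.Perm (Fin n), permLabelMap K σ z - z ∈
          (chainSpace K (KosSym K n (symIdeal K n r L) μ) (j + 1)).map (labelBd K) := by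
  set S := KosSym K n (symIdeal K n r L) μ
  have hdown : ∀ a F, (a, F) ∈ S → ∀ v ∈ F, (a, F.erase v) ∈ S :=
    fun a F hF v _ => KosSym_mono hF (Finset.erase_subset v F)
  have hmem : ∀ x : ChainIdx S j →₀ K, x ∈ invCycles K n S j ↔ x ∈ cycles K S j ∧
      ∀ σ : Equiv.Perm (Fin n), permLabelMap K σ (chainIncl K S j x) - chainIncl K S j x ∈
        (chainSpace K S (j + 1)).map (labelBd K) := by
    intro x
    rw [invCycles, Submodule.mem_inf, Submodule.mem_iInf]
    refine and_congr_right fun _ => forall_congr' fun σ => ?_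
    rw [Submodule.mem_comap, LinearMap.sub_apply, LinearMap.id_apply, ← chainIncl_permAct,
      ← map_sub, ← map_chainIncl_range_bd hdown, Submodule.mem_map]
    exact ⟨fun h => ⟨_, h, rfl⟩, fun ⟨y, hy, he⟩ => chainIncl_injective S j he ▸ hy⟩
  rw [← and_assoc, ← LinearMap.mem_ker, ← Submodule.mem_inf, ← map_chainIncl_cycles hdown]
  simp only [Submodule.mem_map, hmem]
  constructor
  · rintro ⟨x, ⟨hx, hinv⟩, rfl⟩
    exact ⟨⟨x, hx, rfl⟩, by simpa only [Submodule.mem_map] using hinv⟩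
  · rintro ⟨⟨x, hx, rfl⟩, hinv⟩
    exact ⟨x, ⟨hx, by simpa only [Submodule.mem_map] using hinv⟩, rfl⟩

lemma finite_KosSym (I : Ideal (MvPolynomial (Fin n) K)) (μ : Fin n → ℕ) :
    (KosSym K n I μ).Finite := by
  refine ((Set.finite_range fun σ : Equiv.Perm (Fin n) => μ ∘ σ).prod
    (Finset.range n).powerset.finite_toSet).subset ?_
  rintro ⟨a, F⟩ ⟨⟨σ, hσ⟩, hF, -⟩
  exact ⟨⟨σ, hσ.symm⟩, Finset.mem_coe.mpr (Finset.mem_powerset.mpr hF)⟩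

lemma finite_lab_KosI (I : Ideal (MvPolynomial (Fin n) K)) (μ : Fin n → ℕ) :
    (lab (KosI K n I μ)).Finite := by
  refine (Set.finite_univ.prod (Finset.range n).powerset.finite_toSet).subset ?_
  rintro ⟨a, F⟩ ⟨hF, -⟩
  exact ⟨trivial, Finset.mem_coe.mpr (Finset.mem_powerset.mpr hF)⟩

lemma finiteDimensional_chains {α : Type} {S : Set (α × Finset ℕ)} (hS : S.Finite) (j : ℕ) :
    FiniteDimensional K (ChainIdx S j →₀ K) := by
  have : Finite (ChainIdx S j) :=
    (hS.subset (t := {q | q ∈ S ∧ q.2.card = j}) fun q hq => hq.1).to_subtype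
  infer_instance

end Symmetrization

/-- Let `λ^1, …, λ^r ∈ P_n`, `I = ⟨λ^1, …, λ^r⟩_{S_n}`,
`J = (x^{λ^1}, …, x^{λ^r})`, and suppose `char k = 0` or `char k > n`.  Then for every
`i ≥ 0` there is an isomorphism `Tor_i(I,k)^{S_n} ≅ Tor_i(J,k)` of `k`-vector spaces;
more precisely, for every partition `μ ∈ P_n`,
`dim_k (Tor_i(I,k)_{⟨μ⟩})^{S_n} = dim_k Tor_i(J,k)_μ`. -/
theorem statement_3 (K : Type) [Field K] (n r : ℕ)
    (hchar : ringChar K = 0 ∨ n < ringChar K)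
    (L : Fin r → Fin n → ℕ) (hL : ∀ j, Antitone (L j)) :
    ∀ (μ : Fin n → ℕ), Antitone μ → ∀ i : ℕ,
      torInvDim K n (symIdeal K n r L) μ i =
        torDim K n (unsymIdeal K n r L) i μ := by
  intro μ hμ i
  set S := KosSym K n (symIdeal K n r L) μ
  set T := lab (KosI K n (unsymIdeal K n r L) μ)
  have hSdown : ∀ a F, (a, F) ∈ S → ∀ v ∈ F, (a, F.erase v) ∈ S :=
    fun a F hF v _ => KosSym_mono hF (Finset.erase_subset v F)
  have hTdown : ∀ a F, (a, F) ∈ T → ∀ v ∈ F, (a, F.erase v) ∈ T :=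
    fun a F hF v _ => KosI_mono hF (Finset.erase_subset v F)
  have hSfin := finiteDimensional_chains (K := K) (finite_KosSym (symIdeal K n r L) μ) i
  have hTfin := finiteDimensional_chains (K := K) (finite_lab_KosI (unsymIdeal K n r L) μ) i
  have hfact := factorial_ne_zero_of_ringChar hchar
  rw [torInvDim, torDim, rhd0, rhd, ← finrank_map_chainIncl (invCycles K n S i),
    ← finrank_map_chainIncl (_ ⊓ invCycles K n S i), ← finrank_map_chainIncl (cycles K T i),
    ← finrank_map_chainIncl (_ ⊓ cycles K T i), Submodule.map_inf _ (chainIncl_injective S i),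
    Submodule.map_inf _ (chainIncl_injective T i), map_chainIncl_range_bd hSdown,
    map_chainIncl_range_bd hTdown]
  have hprism : ∀ z ∈ chainSpace K T i, labelBd K z = 0 →
      blockEndMap K μ (withLabel K μ z) - z ∈ (chainSpace K T (i + 1)).map (labelBd K) := by
    intro z hz hdz
    have h := labelBd_prism_add μ z
    rw [hdz, map_zero, add_zero] at h
    refine ⟨-labelMap K id (fun _ => prism K (blockEnd μ μ)) z, neg_mem (prism_mem hL μ hz), ?_⟩
    rw [map_neg, eq_sub_iff_add_eq, neg_add_eq_iff_eq_add]
    exact h.symm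
  refine finrank_sub_finrank_inf_eq (blockEndMap K μ) ?_ ?_ ?_ ?_
  · intro z hz
    obtain ⟨hz, hdz, -⟩ := (mem_map_chainIncl_invCycles L μ i z).mp hz
    rw [map_chainIncl_cycles hTdown]
    exact Submodule.mem_inf.mpr ⟨blockEndMap_mem hL hμ hz, LinearMap.mem_ker.mpr <| by
      rw [labelBd_blockEndMap, hdz, map_zero]⟩
  · rintro z - ⟨w, hw, rfl⟩
    exact ⟨blockEndMap K μ w, blockEndMap_mem hL hμ hw, labelBd_blockEndMap μ w⟩
  · rintro z hz ⟨w, hw, hwz⟩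
    obtain ⟨hz, -, hinv⟩ := (mem_map_chainIncl_invCycles L μ i z).mp hz
    have hsum : normMap K n z - (n.factorial : K) • z ∈
        (chainSpace K S (i + 1)).map (labelBd K) := by
      have := sum_mem (t := Finset.univ) fun σ _ => hinv σ
      simpa [normMap, Finset.sum_sub_distrib, Fintype.card_perm, Nat.cast_smul_eq_nsmul] using this
    have hnorm : normMap K n z ∈ (chainSpace K S (i + 1)).map (labelBd K) :=
      ⟨normMap K n (withLabel K μ w), normMap_mem L μ (withLabel_mem L μ hw), by
        rw [labelBd_normMap, labelBd_withLabel, hwz, normMap_withLabel_blockEndMap hchar L μ hz]⟩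
    have hdiff := sub_mem hnorm hsum
    rw [sub_sub_cancel] at hdiff
    exact (Submodule.smul_mem_iff _ hfact).mp hdiff
  · intro z hz
    rw [map_chainIncl_cycles hTdown] at hz
    obtain ⟨hz, hdz⟩ := Submodule.mem_inf.mp hz
    rw [LinearMap.mem_ker] at hdz
    refine ⟨(n.factorial : K)⁻¹ • normMap K n (withLabel K μ z), ?_, ?_⟩
    · refine Submodule.smul_mem _ _ ((mem_map_chainIncl_invCycles L μ i _).mpr ⟨?_, ?_, ?_⟩)
      · exact normMap_mem L μ (withLabel_mem L μ hz)
      · rw [labelBd_normMap, labelBd_withLabel, hdz, map_zero, map_zero]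
      · intro σ
        rw [permLabelMap_normMap, sub_self]
        exact zero_mem _
    · rw [map_smul, blockEndMap_normMap, inv_smul_smul₀ hfact]
      exact hprism z hz hdz
end
end

section
/- Let I ⊆ R be a nonzero, proper S_n-invariant monomial ideal and let ρ = (∞^{p_0},d_1^{p_1},…,d_s^{p_s}) ∈ Λ*_max(I) with ∞ > d_1 > ⋯ > d_s ≥ 0. Then the multigraded Betti number β_{n−p_0, ρ̃}(R/I) = dim_k Tor_{n−p_0}(R/I,k)_{ρ̃} equals the binomial coefficient C(p_0+p_1−1, p_0). -/
open scoped BigOperators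

noncomputable section
open Classical

section SimplexQuotient

variable (K : Type) [Field K]

/-- The sign with which `F.erase v` occurs in the simplicial boundary of `F`. -/
def faceSign (F : Finset ℕ) (v : ℕ) : K :=
  (-1 : K) ^ (F.filter (fun u => u ≤ v)).card

/-- The incidence number of the faces `F` and `G`. -/
def incidence (F G : Finset ℕ) : K :=
  ∑ v ∈ F, if F.erase v = G then faceSign K F v else 0

lemma faceSign_ne_zero (F : Finset ℕ) (v : ℕ) : faceSign K F v ≠ 0 :=
  pow_ne_zero _ (neg_ne_zero.mpr one_ne_zero)

lemma faceSign_erase_of_lt {F : Finset ℕ} {u v : ℕ} (h : u < v) :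
    faceSign K (F.erase v) u = faceSign K F u := by
  unfold faceSign
  congr 2
  ext w
  simp only [Finset.mem_filter, Finset.mem_erase]
  constructor
  · rintro ⟨⟨-, h1⟩, h2⟩
    exact ⟨h1, h2⟩
  · rintro ⟨h1, h2⟩
    exact ⟨⟨by omega, h1⟩, h2⟩

lemma faceSign_erase_of_gt {F : Finset ℕ} {u v : ℕ} (hv : v ∈ F) (h : v < u) :
    faceSign K (F.erase v) u = -faceSign K F u := by
  unfold faceSign
  have h1 : (F.erase v).filter (fun w => w ≤ u) = (F.filter (fun w => w ≤ u)).erase v := by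
    ext w
    simp only [Finset.mem_filter, Finset.mem_erase]
    tauto
  have h2 : v ∈ F.filter (fun w => w ≤ u) := Finset.mem_filter.mpr ⟨hv, h.le⟩
  rw [h1, ← Finset.card_erase_add_one h2, pow_succ]
  ring

lemma faceSign_mul_erase_add {F : Finset ℕ} {u v : ℕ} (hu : u ∈ F) (hv : v ∈ F) (h : u ≠ v) :
    faceSign K F v * faceSign K (F.erase v) u +
      faceSign K F u * faceSign K (F.erase u) v = 0 := by
  rcases lt_or_gt_of_ne h with h | h
  · rw [faceSign_erase_of_lt K h, faceSign_erase_of_gt K hu h]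
    ring
  · rw [faceSign_erase_of_lt K h, faceSign_erase_of_gt K hv h]
    ring

lemma sum_faceSign_mul_incidence_erase (F E : Finset ℕ) :
    ∑ v ∈ F, faceSign K F v * incidence K (F.erase v) E = 0 := by
  simp only [incidence, Finset.mul_sum]
  rw [Finset.sum_sigma']
  refine Finset.sum_involution (fun x _ => ⟨x.2, x.1⟩) ?_ ?_ ?_ ?_
  · rintro ⟨v, u⟩ hx
    simp only [Finset.mem_sigma, Finset.mem_erase] at hx
    obtain ⟨hv, huv, hu⟩ := hx
    dsimp only
    rw [Finset.erase_right_comm]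
    by_cases h : (F.erase u).erase v = E
    · rw [if_pos h, if_pos h]
      exact faceSign_mul_erase_add K hu hv huv
    · rw [if_neg h, if_neg h]
      simp
  · rintro ⟨v, u⟩ hx - heq
    simp only [Finset.mem_sigma, Finset.mem_erase] at hx
    exact hx.2.1 (congrArg Sigma.fst heq)
  · rintro ⟨v, u⟩ hx
    simp only [Finset.mem_sigma, Finset.mem_erase] at hx ⊢
    exact ⟨hx.2.2, Ne.symm hx.2.1, hx.1⟩
  · rintro ⟨v, u⟩ hx
    rfl

lemma exists_erase_of_incidence_ne_zero {F G : Finset ℕ} (h : incidence K F G ≠ 0) :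
    ∃ v ∈ F, F.erase v = G := by
  obtain ⟨v, hv, hv'⟩ := Finset.exists_ne_zero_of_sum_ne_zero h
  exact ⟨v, hv, by_contra fun hne => hv' (if_neg hne)⟩

lemma incidence_insert {G : Finset ℕ} {v : ℕ} (hv : v ∉ G) :
    incidence K (insert v G) G = faceSign K (insert v G) v := by
  unfold incidence
  rw [Finset.sum_eq_single v]
  · rw [if_pos (Finset.erase_insert hv)]
  · intro w hw hwv
    refine if_neg fun h => hv ?_
    rw [← h]
    exact Finset.mem_erase.mpr ⟨Ne.symm hwv, Finset.mem_insert_self v G⟩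
  · exact fun h => absurd (Finset.mem_insert_self v G) h

lemma incidence_eq_zero {F G : Finset ℕ} {v : ℕ} (hF : v ∈ F) (hG : v ∉ G)
    (h : F ≠ insert v G) : incidence K F G = 0 := by
  by_contra hne
  obtain ⟨w, hw, rfl⟩ := exists_erase_of_incidence_ne_zero K hne
  have hvw : v = w := by
    by_contra hvw
    exact hG (Finset.mem_erase.mpr ⟨hvw, hF⟩)
  subst hvw
  exact h (Finset.insert_erase hw).symm

namespace ChainIdx

variable {Δ : Set (Finset ℕ)} {j : ℕ}

/-- The underlying face of a basis element. -/
def face (q : ChainIdx (lab Δ) j) : Finset ℕ := q.1.2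

/-- The basis element given by a face. -/
def ofFace (F : Finset ℕ) (hF : F ∈ Δ) (hc : F.card = j) : ChainIdx (lab Δ) j :=
  ⟨((), F), hF, hc⟩

lemma face_ofFace (F : Finset ℕ) (hF : F ∈ Δ) (hc : F.card = j) :
    (ofFace F hF hc).face = F := rfl

lemma face_mem (q : ChainIdx (lab Δ) j) : q.face ∈ Δ := q.2.1

lemma card_face (q : ChainIdx (lab Δ) j) : q.face.card = j := q.2.2

lemma face_injective : Function.Injective (face : ChainIdx (lab Δ) j → Finset ℕ) :=
  fun _ _ h => Subtype.ext (Prod.ext rfl h)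

end ChainIdx

open ChainIdx

lemma bdElt_lab (Δ : Set (Finset ℕ)) (j : ℕ) (q : ChainIdx (lab Δ) (j + 1)) :
    bdElt K (lab Δ) j q = ∑ v ∈ q.face,
      if h : q.face.erase v ∈ Δ ∧ (q.face.erase v).card = j then
        faceSign K q.face v • Finsupp.single (ofFace (q.face.erase v) h.1 h.2) (1 : K)
      else 0 := rfl

lemma bdElt_apply (Δ : Set (Finset ℕ)) (j : ℕ) (q : ChainIdx (lab Δ) (j + 1))
    (G : ChainIdx (lab Δ) j) :
    bdElt K (lab Δ) j q G = incidence K q.face G.face := by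
  rw [bdElt_lab, incidence, Finsupp.finsetSum_apply]
  refine Finset.sum_congr rfl fun v hv => ?_
  by_cases hG : q.face.erase v = G.face
  · have h : q.face.erase v ∈ Δ ∧ (q.face.erase v).card = j := by
      rw [hG]
      exact ⟨G.face_mem, G.card_face⟩
    have hG' : ofFace (q.face.erase v) h.1 h.2 = G := face_injective hG
    rw [dif_pos h, if_pos hG, hG', Finsupp.smul_apply, Finsupp.single_eq_same, smul_eq_mul,
      mul_one]
  · rw [if_neg hG]
    split_ifs with h
    · rw [Finsupp.smul_apply, Finsupp.single_eq_of_ne, smul_zero]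
      rintro rfl
      exact hG rfl
    · rfl

/-- Suppose that `Δ` has no face with `i` elements, that its faces with `i + 1` elements are
exactly the sets between `R` and `U`, and that it contains all such sets with `i + 2` elements.
Then its homology in cardinality `i + 1` is that of a simplex modulo a skeleton. -/
lemma rhd0_eq_choose (Δ : Set (Finset ℕ)) (U R : Finset ℕ) (hRU : R ⊆ U) (v : ℕ) (hvU : v ∈ U)
    (hvR : v ∉ R) (i : ℕ) (hRi : R.card ≤ i) (hΔU : ∀ F ∈ Δ, F ⊆ U)
    (hlow : ∀ F ∈ Δ, F.card ≠ i)
    (hmid : ∀ F, F.card = i + 1 → (F ∈ Δ ↔ R ⊆ F ∧ F ⊆ U))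
    (hup : ∀ F, F.card = i + 2 → R ⊆ F → F ⊆ U → F ∈ Δ) :
    rhd0 K Δ (i + 1) = (U.card - R.card - 1).choose (i - R.card) := by
  have hfin : Finite (ChainIdx (lab Δ) (i + 1)) := by
    refine Finite.of_injective
      (fun q : ChainIdx (lab Δ) (i + 1) => (⟨q.face, ?_⟩ : {F // F ∈ U.powerset})) ?_
    · exact Finset.mem_powerset.mpr (hΔU _ q.face_mem)
    · intro q q' h
      exact face_injective (congrArg Subtype.val h)
  have hcyc : cycles K (lab Δ) (i + 1) = ⊤ := by
    have : IsEmpty (ChainIdx (lab Δ) i) := ⟨fun q => hlow _ q.face_mem q.card_face⟩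
    refine eq_top_iff.mpr fun x _ => ?_
    exact LinearMap.mem_ker.mpr (Subsingleton.elim _ _)
  let A : Finset (Finset ℕ) := ((U \ R).erase v).powersetCard (i - R.card)
  have hA : ∀ T ∈ A, (R ∪ T ⊆ U ∧ v ∉ R ∪ T ∧ (R ∪ T) \ R = T) ∧ (R ∪ T).card = i := by
    intro T hT
    obtain ⟨hT, hTc⟩ := Finset.mem_powersetCard.mp hT
    have hdisj : Disjoint R T := by
      rw [Finset.disjoint_left]
      intro x hx hxT
      exact (Finset.mem_sdiff.mp (Finset.mem_of_mem_erase (hT hxT))).2 hx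
    refine ⟨⟨Finset.union_subset hRU fun x hx => ?_, ?_, ?_⟩, ?_⟩
    · exact (Finset.mem_sdiff.mp (Finset.mem_of_mem_erase (hT hx))).1
    · intro h
      rcases Finset.mem_union.mp h with h | h
      · exact hvR h
      · exact Finset.notMem_erase v _ (hT h)
    · rw [Finset.union_sdiff_left, hdisj.symm.sdiff_eq_left]
    · rw [Finset.card_union_of_disjoint hdisj, hTc]
      omega
  let Φ : (ChainIdx (lab Δ) (i + 1) →₀ K) →ₗ[K] (A → K) :=
    Finsupp.linearCombination K fun q T => incidence K q.face (R ∪ T.1)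
  have hins : ∀ T : A, ∃ q : ChainIdx (lab Δ) (i + 1), q.face = insert v (R ∪ T.1) := by
    intro T
    obtain ⟨⟨h1, h2, h3⟩, h4⟩ := hA T.1 T.2
    have hc : (insert v (R ∪ T.1)).card = i + 1 := by rw [Finset.card_insert_of_notMem h2, h4]
    refine ⟨ofFace _ ((hmid _ hc).mpr ⟨?_, ?_⟩) hc, rfl⟩
    · exact Finset.subset_union_left.trans (Finset.subset_insert _ _)
    · exact Finset.insert_subset hvU h1
  have hΦsurj : LinearMap.range Φ = ⊤ := by
    rw [eq_top_iff, ← (Pi.basisFun K A).span_eq, Submodule.span_le]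
    rintro _ ⟨T, rfl⟩
    obtain ⟨q, hq⟩ := hins T
    obtain ⟨⟨h1, h2, h3⟩, h4⟩ := hA T.1 T.2
    refine ⟨Finsupp.single q (faceSign K q.face v)⁻¹, ?_⟩
    simp only [Φ, Finsupp.linearCombination_single]
    funext T'
    rw [Pi.smul_apply, smul_eq_mul, Pi.basisFun_apply]
    by_cases hT : T' = T
    · subst hT
      rw [hq, incidence_insert K h2, inv_mul_cancel₀ (faceSign_ne_zero K _ _), Pi.single_eq_same]
    · obtain ⟨⟨h1', h2', h3'⟩, h4'⟩ := hA T'.1 T'.2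
      rw [Pi.single_eq_of_ne hT, incidence_eq_zero K (v := v), mul_zero]
      · rw [hq]
        exact Finset.mem_insert_self _ _
      · exact h2'
      · rw [hq]
        intro h
        have h5 := congrArg (fun s => s.erase v) h
        simp only [Finset.erase_insert h2, Finset.erase_insert h2'] at h5
        exact hT (Subtype.ext (by rw [← h3', ← h5, h3]))
  have hle : LinearMap.range (bd K (lab Δ) (i + 1)) ≤ LinearMap.ker Φ := by
    rw [LinearMap.range_le_ker_iff]
    refine Finsupp.lhom_ext' fun q => LinearMap.ext_ring ?_
    funext T
    simp only [LinearMap.comp_apply, Finsupp.lsingle_apply, bd,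
      Finsupp.linearCombination_single, one_smul, bdElt_lab, map_sum]
    rw [Finset.sum_apply, LinearMap.zero_apply, Pi.zero_apply,
      ← sum_faceSign_mul_incidence_erase K q.face (R ∪ T.1)]
    refine Finset.sum_congr rfl fun w hw => ?_
    split_ifs with h
    · simp only [Φ, map_smul, Finsupp.linearCombination_single, one_smul, Pi.smul_apply,
        smul_eq_mul, face_ofFace]
    · rw [map_zero, Pi.zero_apply]
      by_contra hne
      obtain ⟨u, hu, hE⟩ := exists_erase_of_incidence_ne_zero K
        (right_ne_zero_of_mul (Ne.symm hne))
      have hc : (q.face.erase w).card = i + 1 := by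
        rw [Finset.card_erase_of_mem hw, q.card_face]
        rfl
      refine h ⟨(hmid _ hc).mpr ⟨?_, ?_⟩, hc⟩
      · exact Finset.subset_union_left.trans (hE ▸ Finset.erase_subset _ _)
      · exact (Finset.erase_subset _ _).trans (hΔU _ q.face_mem)
  have hker : LinearMap.range (bd K (lab Δ) (i + 1)) = LinearMap.ker Φ := by
    apply le_antisymm
    · exact hle
    · let N : Submodule K (ChainIdx (lab Δ) (i + 1) →₀ K) :=
        Finsupp.supported K K {q | v ∈ q.face}
      have htop : LinearMap.range (bd K (lab Δ) (i + 1)) ⊔ N = ⊤ := by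
        rw [eq_top_iff]
        rintro x -
        induction x using Finsupp.induction_linear with
        | zero => exact Submodule.zero_mem _
        | add x y hx hy => exact Submodule.add_mem _ hx hy
        | single q c =>
          by_cases hq : v ∈ q.face
          · exact Submodule.mem_sup_right (Finsupp.single_mem_supported K c hq)
          · obtain ⟨h1, h2⟩ := (hmid _ q.card_face).mp q.face_mem
            have hc : (insert v q.face).card = i + 2 := by
              rw [Finset.card_insert_of_notMem hq, q.card_face]
            let q' : ChainIdx (lab Δ) (i + 1 + 1) :=
              ofFace (insert v q.face) (hup _ hc (h1.trans (Finset.subset_insert _ _))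
                (Finset.insert_subset hvU h2)) hc
            let y := bd K (lab Δ) (i + 1)
              (Finsupp.single q' (c * (faceSign K (insert v q.face) v)⁻¹))
            rw [← add_sub_cancel y (Finsupp.single q c)]
            refine Submodule.add_mem_sup ⟨_, rfl⟩ ?_
            refine (Finsupp.mem_supported' K _).mpr fun G hG => ?_
            simp only [y, bd, Finsupp.linearCombination_single, Finsupp.sub_apply,
              Finsupp.smul_apply, bdElt_apply, smul_eq_mul, q', face_ofFace]
            by_cases hGq : G = q
            · subst hGq
              rw [Finsupp.single_eq_same, incidence_insert K hq, mul_assoc,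
                inv_mul_cancel₀ (faceSign_ne_zero K _ _), mul_one, sub_self]
            · rw [Finsupp.single_eq_of_ne hGq, incidence_eq_zero K
                (Finset.mem_insert_self v _) hG, mul_zero, sub_zero]
              intro h
              have h5 := congrArg (fun s => s.erase v) h
              simp only [Finset.erase_insert hq, Finset.erase_insert hG] at h5
              exact hGq (face_injective h5.symm)
      have hN : ∀ z ∈ N, Φ z = 0 → z = 0 := by
        intro z hz hz0
        ext q
        rw [Finsupp.zero_apply]
        by_cases hq : v ∈ q.face
        · obtain ⟨h1, h2⟩ := (hmid _ q.card_face).mp q.face_mem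
          have hT : (q.face.erase v) \ R ∈ A := by
            refine Finset.mem_powersetCard.mpr ⟨?_, ?_⟩
            · intro x hx
              simp only [Finset.mem_sdiff, Finset.mem_erase] at hx ⊢
              exact ⟨hx.1.1, h2 hx.1.2, hx.2⟩
            · rw [Finset.card_sdiff_of_subset (Finset.subset_erase.mpr ⟨h1, hvR⟩),
                Finset.card_erase_of_mem hq, q.card_face, Nat.add_sub_cancel]
          have hE : R ∪ ((q.face.erase v) \ R) = q.face.erase v :=
            Finset.union_sdiff_of_subset (Finset.subset_erase.mpr ⟨h1, hvR⟩)
          have hval := congrFun hz0 ⟨_, hT⟩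
          simp only [Φ, Finsupp.linearCombination_apply, Finsupp.sum, Finset.sum_apply,
            Pi.smul_apply, smul_eq_mul, Pi.zero_apply, hE] at hval
          rw [Finset.sum_eq_single q] at hval
          · have hi := incidence_insert K (Finset.notMem_erase v q.face)
            rw [Finset.insert_erase hq] at hi
            rw [hi] at hval
            exact (mul_eq_zero.mp hval).resolve_right (faceSign_ne_zero K _ _)
          · intro G hG hGq
            have hvG : v ∈ G.face := (Finsupp.mem_supported K z).mp hz hG
            rw [incidence_eq_zero K hvG (Finset.notMem_erase v _), mul_zero]
            rw [Finset.insert_erase hq]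
            exact fun h => hGq (face_injective h)
          · intro h
            rw [Finsupp.notMem_support_iff.mp h, zero_mul]
        · exact (Finsupp.mem_supported' K z).mp hz q hq
      intro x hx
      obtain ⟨y, hy, z, hz, rfl⟩ := Submodule.mem_sup.mp (htop ▸ Submodule.mem_top : x ∈ _ ⊔ N)
      rw [LinearMap.mem_ker, map_add, LinearMap.mem_ker.mp (hle hy), zero_add] at hx
      rw [hN z hz hx, add_zero]
      exact hy
  have hdim := LinearMap.finrank_range_add_finrank_ker Φ
  rw [hΦsurj, finrank_top, Module.finrank_fintype_fun_eq_card, Fintype.card_coe,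
    Finset.card_powersetCard, Finset.card_erase_of_mem (Finset.mem_sdiff.mpr ⟨hvU, hvR⟩),
    Finset.card_sdiff_of_subset hRU] at hdim
  unfold rhd0 rhd
  rw [hcyc, inf_top_eq, finrank_top, hker]
  omega

end SimplexQuotient

section DualGenerators

variable {n : ℕ}

lemma le_of_comp_perm_le {α : Type} [LinearOrder α] {b μ : Fin n → α} (hb : Antitone b)
    (hμ : Antitone μ) (σ : Equiv.Perm (Fin n)) (h : ∀ i, b (σ i) ≤ μ i) (i : Fin n) :
    b i ≤ μ i := by
  by_contra! hi
  have hmaps : ∀ j ∈ Finset.Ici i, σ j ∈ Finset.Ioi i := by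
    intro j hj
    rw [Finset.mem_Ici] at hj
    rw [Finset.mem_Ioi]
    by_contra! hle
    exact absurd ((hb hle).trans ((h j).trans (hμ hj))) (not_le.mpr hi)
  have hcard := Finset.card_le_card_of_injOn σ hmaps σ.injective.injOn
  rw [Fin.card_Ici, Fin.card_Ioi] at hcard
  omega

lemma exists_perm_sub_antitone {a e : Fin n → ℕ} (ha : Antitone a) (he : ∀ i, e i ≤ 1) :
    ∃ τ : Equiv.Perm (Fin n), (∀ i, a (τ i) = a i) ∧ Antitone fun i => a i - e (τ i) := by
  have hτ := Tuple.monotone_sort fun i => (e i : ℤ) - 2 * a i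
  set τ := Tuple.sort fun i => (e i : ℤ) - 2 * a i
  have hkey : ∀ i j, i ≤ j → (e (τ i) : ℤ) - 2 * a (τ i) ≤ e (τ j) - 2 * a (τ j) :=
    fun i j hij => hτ hij
  have haτ : Antitone fun i => a (τ i) := by
    intro i j hij
    have h1 := hkey i j hij
    have h2 := he (τ i)
    have h3 := he (τ j)
    dsimp only
    omega
  have heq : ∀ i, a (τ i) = a i := fun i => le_antisymm
    (le_of_comp_perm_le haτ ha τ⁻¹ (fun i => by simp) i)
    (le_of_comp_perm_le ha haτ τ (fun i => le_rfl) i)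
  refine ⟨τ, heq, fun i j hij => ?_⟩
  have h1 := hkey i j hij
  rw [heq, heq] at h1
  have h2 := he (τ i)
  have h3 := he (τ j)
  dsimp only
  omega

lemma toNat_le_topVal (μ : Fin n → ℕ∞) (i : Fin n) : (μ i).toNat ≤ topVal n μ :=
  Finset.le_sup (f := fun i => (μ i).toNat) (Finset.mem_univ i)

lemma tildeOf_le (μ : Fin n → ℕ∞) (i : Fin n) : tildeOf n μ i ≤ topVal n μ + 1 := by
  have := toNat_le_topVal μ i
  unfold tildeOf
  split_ifs <;> omega

lemma tildeOf_of_eq_top {μ : Fin n → ℕ∞} {i : Fin n} (h : μ i = ⊤) :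
    tildeOf n μ i = topVal n μ + 1 := if_pos h

lemma tildeOf_of_ne_top {μ : Fin n → ℕ∞} {i : Fin n} (h : μ i ≠ ⊤) :
    tildeOf n μ i = (μ i).toNat + 1 := if_neg h

lemma tildeOf_pos (μ : Fin n → ℕ∞) (i : Fin n) : 1 ≤ tildeOf n μ i := by
  unfold tildeOf
  split_ifs <;> omega

lemma tildeOf_antitone {μ : Fin n → ℕ∞} (hμ : Antitone μ) : Antitone (tildeOf n μ) := by
  intro i j hij
  by_cases hi : μ i = ⊤
  · rw [tildeOf_of_eq_top hi]
    exact tildeOf_le μ j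
  · have hj : μ j ≠ ⊤ := ne_top_of_le_ne_top hi (hμ hij)
    rw [tildeOf_of_ne_top hi, tildeOf_of_ne_top hj]
    exact Nat.succ_le_succ (ENat.toNat_le_toNat (hμ hij) hi)

lemma ellInf_eq_sum (μ : Fin n → ℕ∞) : ellInf n μ = ∑ i, if μ i = ⊤ then 1 else 0 := by
  rw [ellInf, Finset.card_filter]

lemma le_of_coe_le_of_ne_top {m : ℕ} {x : ℕ∞} (h : (m : ℕ∞) ≤ x) (hx : x ≠ ⊤) : m ≤ x.toNat := by
  lift x to ℕ using hx
  simpa using h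

lemma coe_le_of_le_toNat {m : ℕ} {x : ℕ∞} (h : x ≠ ⊤ → m ≤ x.toNat) : (m : ℕ∞) ≤ x := by
  by_cases hx : x = ⊤
  · simp [hx]
  · lift x to ℕ using hx
    simpa using h (by simp)

/-- If `ρ̃ - e ≤ μ` for a `0/1`-vector `e`, then `ρ̃ ≤ μ̃` or `ρ ≤ μ`. -/
lemma tildeOf_le_or_le {ρ μ : Fin n → ℕ∞} {e : Fin n → ℕ} (he : ∀ i, e i ≤ 1)
    (h : ∀ i, ((tildeOf n ρ i - e i : ℕ) : ℕ∞) ≤ μ i) :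
    (∀ i, tildeOf n ρ i ≤ tildeOf n μ i) ∨ (topVal n μ < topVal n ρ ∧ ∀ i, ρ i ≤ μ i) := by
  by_cases hle : ∀ i, tildeOf n ρ i ≤ tildeOf n μ i
  · exact Or.inl hle
  push Not at hle
  obtain ⟨i, hi⟩ := hle
  have htop : μ i = ⊤ := by
    by_contra hne
    have h1 := le_of_coe_le_of_ne_top (h i) hne
    have h2 := he i
    rw [tildeOf_of_ne_top hne] at hi
    omega
  have hlt : topVal n μ < topVal n ρ := by
    have h1 := tildeOf_le ρ i
    rw [tildeOf_of_eq_top htop] at hi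
    omega
  refine Or.inr ⟨hlt, fun j => ?_⟩
  by_cases hj : μ j = ⊤
  · simp [hj]
  have h1 := le_of_coe_le_of_ne_top (h j) hj
  have h2 := he j
  have h3 := toNat_le_topVal μ j
  have hρ : ρ j ≠ ⊤ := by
    intro hρ
    rw [tildeOf_of_eq_top hρ] at h1
    omega
  rw [tildeOf_of_ne_top hρ] at h1
  rw [← ENat.natCast_toNat hρ]
  exact coe_le_of_le_toNat fun _ => by omega

lemma lt_of_not_preceq {ρ μ : Fin n → ℕ∞} {e : Fin n → ℕ}
    (h : ∀ i, ((tildeOf n ρ i - e i : ℕ) : ℕ∞) ≤ μ i)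
    (hle : ∀ i, tildeOf n ρ i ≤ tildeOf n μ i) (hnot : ¬ preceq n ρ μ) :
    n < ∑ i, e i + ellInf n ρ := by
  have hsum : ∑ i : Fin n, (1 + tildeOf n ρ i) ≤
      ∑ i, (e i + (if μ i = ⊤ then 1 else 0) + tildeOf n μ i) := by
    refine Finset.sum_le_sum fun i _ => ?_
    have h1 := hle i
    split_ifs with hi
    · omega
    · have h2 := le_of_coe_le_of_ne_top (h i) hi
      rw [tildeOf_of_ne_top hi]
      omega
  simp only [Finset.sum_add_distrib, ← ellInf_eq_sum, Finset.sum_const, Finset.card_univ,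
    Fintype.card_fin, smul_eq_mul, mul_one] at hsum
  have hlt := not_le.mp fun h' => hnot ⟨hle, h'⟩
  omega

lemma le_sum_add_ellInf {ρ : Fin n → ℕ∞} {e : Fin n → ℕ}
    (h : ∀ i, ((tildeOf n ρ i - e i : ℕ) : ℕ∞) ≤ ρ i) : n ≤ ∑ i, e i + ellInf n ρ := by
  have hsum : ∑ i : Fin n, 1 ≤ ∑ i, (e i + (if ρ i = ⊤ then 1 else 0)) := by
    refine Finset.sum_le_sum fun i _ => ?_
    split_ifs with hi
    · omega
    · have h2 := le_of_coe_le_of_ne_top (h i) hi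
      rw [tildeOf_of_ne_top hi] at h2
      omega
  simpa only [Finset.sum_add_distrib, ← ellInf_eq_sum, Finset.sum_const, Finset.card_univ,
    Fintype.card_fin, smul_eq_mul, mul_one] using hsum

/-- A rearrangement of `ρ̃ - e` which is a partition lies below `ρ` as soon as `e` does not miss
more than `ℓ(ρ)` positions, all of them carrying the largest entry of `ρ̃`. -/
lemma tildeOf_sub_le {ρ : Fin n → ℕ∞} (hρ : Antitone ρ) {e : Fin n → ℕ} (he : ∀ i, e i ≤ 1)
    (hanti : Antitone fun i => tildeOf n ρ i - e i)
    (hR : ∀ i, tildeOf n ρ i ≠ topVal n ρ + 1 → e i = 1) (hn : n ≤ ∑ i, e i + ellInf n ρ)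
    (i : Fin n) : ((tildeOf n ρ i - e i : ℕ) : ℕ∞) ≤ ρ i := by
  refine coe_le_of_le_toNat fun hi => ?_
  by_cases hei : e i = 1
  · rw [tildeOf_of_ne_top hi]
    omega
  exfalso
  have hi0 : e i = 0 := by have := he i; omega
  have hti : tildeOf n ρ i = topVal n ρ + 1 := by_contra fun h => hei (hR i h)
  have hzero : ∀ j, ρ j = ⊤ → e j = 0 := by
    intro j hj
    have hji : j ≤ i := by
      by_contra! hlt
      exact hi (top_le_iff.mp (hj ▸ hρ hlt.le))
    have h1 := hanti hji
    have h2 := tildeOf_of_eq_top hj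
    simp only [hti, hi0, h2] at h1
    omega
  have hlt : ∑ j : Fin n, (e j + (if ρ j = ⊤ then 1 else 0)) < ∑ j : Fin n, 1 := by
    refine Finset.sum_lt_sum (fun j _ => ?_) ⟨i, Finset.mem_univ i, ?_⟩
    · have h1 := he j
      split_ifs with hj
      · rw [hzero j hj]
      · omega
    · rw [hi0, if_neg hi]
      omega
  simp only [Finset.sum_add_distrib, ← ellInf_eq_sum, Finset.sum_const, Finset.card_univ,
    Fintype.card_fin, smul_eq_mul, mul_one] at hlt
  omega

section Ideals

variable (K : Type) [Field K]

lemma mon_mem_Qgen (μ : Fin n → ℕ∞) (a : Fin n → ℕ) :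
    mon K n a ∈ Qgen K n μ ↔
      ∀ σ : Equiv.Perm (Fin n), ∃ i, μ i ≠ ⊤ ∧ (μ i).toNat + 1 ≤ a (σ i) := by
  rw [Qgen, Submodule.mem_iInf]
  refine forall_congr' fun σ => ?_
  have hX : ∀ (i : Fin n) (m : ℕ),
      (MvPolynomial.rename σ : MvPolynomial (Fin n) K →ₐ[K] _).toRingHom
        (MvPolynomial.X i ^ m) = MvPolynomial.monomial (Finsupp.single (σ i) m) 1 := by
    intro i m
    rw [MvPolynomial.X_pow_eq_monomial]
    exact (MvPolynomial.rename_monomial σ _ 1).trans (by rw [Finsupp.mapDomain_single])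
  have himage : (MvPolynomial.rename σ : MvPolynomial (Fin n) K →ₐ[K] _).toRingHom ''
        {g | ∃ i : Fin n, μ i ≠ ⊤ ∧ g = MvPolynomial.X i ^ ((μ i).toNat + 1)} =
      (fun s => MvPolynomial.monomial s (1 : K)) ''
        {m | ∃ i : Fin n, μ i ≠ ⊤ ∧ m = Finsupp.single (σ i) ((μ i).toNat + 1)} := by
    ext g
    constructor
    · rintro ⟨_, ⟨i, hi, rfl⟩, rfl⟩
      refine ⟨_, ⟨i, hi, rfl⟩, ?_⟩
      exact (hX i _).symm
    · rintro ⟨_, ⟨i, hi, rfl⟩, rfl⟩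
      refine ⟨_, ⟨i, hi, rfl⟩, ?_⟩
      exact hX i _
  rw [Ideal.map_span, himage, MvPolynomial.mem_ideal_span_monomial_image, mon,
    MvPolynomial.support_monomial, if_neg one_ne_zero]
  constructor
  · intro h
    obtain ⟨_, ⟨i, hi, rfl⟩, hle⟩ := h _ (Finset.mem_singleton_self _)
    refine ⟨i, hi, ?_⟩
    simpa using hle (σ i)
  · rintro ⟨i, hi, hle⟩ m hm
    rw [Finset.mem_singleton] at hm
    subst hm
    refine ⟨_, ⟨i, hi, rfl⟩, ?_⟩
    rw [Finsupp.single_le_iff]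
    simpa using hle

lemma mon_notMem_Qgen (μ : Fin n → ℕ∞) (a : Fin n → ℕ) :
    mon K n a ∉ Qgen K n μ ↔ ∃ σ : Equiv.Perm (Fin n), ∀ i, (a (σ i) : ℕ∞) ≤ μ i := by
  rw [mon_mem_Qgen]
  push Not
  refine exists_congr fun σ => forall_congr' fun i => ⟨fun h => ?_, fun h hi => ?_⟩
  · exact coe_le_of_le_toNat fun hi => Nat.lt_succ_iff.mp (h hi)
  · exact Nat.lt_succ_iff.mpr (le_of_coe_le_of_ne_top h hi)

lemma Qgen_le_Qgen {ρ μ : Fin n → ℕ∞} (h : ∀ i, ρ i ≤ μ i) : Qgen K n μ ≤ Qgen K n ρ := by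
  refine iInf_mono fun σ => Ideal.map_mono (Ideal.span_le.mpr ?_)
  rintro _ ⟨i, hi, rfl⟩
  refine Ideal.mem_of_dvd _ (pow_dvd_pow _ ?_)
    (Ideal.subset_span ⟨i, ne_top_of_le_ne_top hi (h i), rfl⟩)
  exact Nat.succ_le_succ (ENat.toNat_le_toNat (h i) hi)

variable {K} {I : Ideal (MvPolynomial (Fin n) K)} {Λ : Finset (Fin n → ℕ∞)}

lemma IsDualPresentation.mon_notMem_iff (h : IsDualPresentation K n I Λ) (a : Fin n → ℕ) :
    mon K n a ∉ I ↔ ∃ μ ∈ Λ, mon K n a ∉ Qgen K n μ := by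
  rw [h.2.1]
  simp only [Submodule.mem_iInf]
  push Not
  rfl

lemma IsDualPresentation.eq_of_le (h : IsDualPresentation K n I Λ) {ρ μ : Fin n → ℕ∞}
    (hρ : ρ ∈ Λ) (hμ : μ ∈ Λ) (hle : ∀ i, ρ i ≤ μ i) : ρ = μ := by
  by_contra hne
  refine h.2.2 ρ hρ (h.2.1.trans (le_antisymm ?_ ?_))
  · exact le_iInf₂ fun ν hν => le_iInf fun _ => iInf₂_le ν hν
  · refine le_iInf₂ fun ν hν => ?_
    by_cases hνρ : ν = ρ
    · subst hνρ
      exact (iInf₂_le_of_le μ hμ (iInf_le _ (Ne.symm hne))).trans (Qgen_le_Qgen K hle)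
    · exact iInf₂_le_of_le ν hν (iInf_le _ hνρ)

lemma exists_perm_of_mon_notMem_Qgen {ρ μ : Fin n → ℕ∞} (hρ : Antitone ρ) (hμ : Antitone μ)
    {e : Fin n → ℕ} (he : ∀ i, e i ≤ 1)
    (h : mon K n (fun i => tildeOf n ρ i - e i) ∉ Qgen K n μ) :
    ∃ τ : Equiv.Perm (Fin n), (∀ i, tildeOf n ρ (τ i) = tildeOf n ρ i) ∧
      ∀ i, ((tildeOf n ρ i - e (τ i) : ℕ) : ℕ∞) ≤ μ i := by
  obtain ⟨σ, hσ⟩ := (mon_notMem_Qgen K μ _).mp h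
  obtain ⟨τ, hτ, hanti⟩ := exists_perm_sub_antitone (tildeOf_antitone hρ) he
  refine ⟨τ, hτ, fun i => ?_⟩
  refine le_of_comp_perm_le (b := fun i => ((tildeOf n ρ i - e (τ i) : ℕ) : ℕ∞))
    (fun i j hij => Nat.cast_le.mpr (hanti hij)) hμ (σ.trans τ.symm) (fun i => ?_) i
  have h1 := hτ (τ.symm (σ i))
  rw [Equiv.apply_symm_apply] at h1
  simpa [← h1] using hσ i

lemma IsDualPresentation.mon_tildeOf_sub_notMem (h : IsDualPresentation K n I Λ)
    {ρ : Fin n → ℕ∞} (hρ : ρ ∈ Λ) {e : Fin n → ℕ} (he : ∀ i, e i ≤ 1)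
    (hR : ∀ i, tildeOf n ρ i ≠ topVal n ρ + 1 → e i = 1) (hn : n ≤ ∑ i, e i + ellInf n ρ) :
    mon K n (fun i => tildeOf n ρ i - e i) ∉ I := by
  refine (h.mon_notMem_iff _).mpr ⟨ρ, hρ, (mon_notMem_Qgen K ρ _).mpr ?_⟩
  have hanti := h.1 ρ hρ
  obtain ⟨τ, hτ, hτanti⟩ := exists_perm_sub_antitone (tildeOf_antitone hanti) he
  refine ⟨τ, fun i => ?_⟩
  rw [hτ]
  refine tildeOf_sub_le hanti (e := fun i => e (τ i)) (fun i => he _) hτanti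
    (fun i hi => hR _ (by rwa [hτ])) ?_ i
  rwa [Equiv.sum_comp τ e]

lemma IsDualPresentation.of_mon_tildeOf_sub_notMem (h : IsDualPresentation K n I Λ)
    {ρ : Fin n → ℕ∞} (hρ : ρ ∈ Λ) (hmax : ∀ μ ∈ Λ, preceq n ρ μ → μ = ρ)
    {e : Fin n → ℕ} (he : ∀ i, e i ≤ 1) (hn : ∑ i, e i + ellInf n ρ ≤ n)
    (hI : mon K n (fun i => tildeOf n ρ i - e i) ∉ I) :
    (∀ i, tildeOf n ρ i ≠ topVal n ρ + 1 → e i = 1) ∧ n ≤ ∑ i, e i + ellInf n ρ := by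
  obtain ⟨μ, hμ, hI⟩ := (h.mon_notMem_iff _).mp hI
  obtain ⟨τ, hτ, hle⟩ := exists_perm_of_mon_notMem_Qgen (h.1 ρ hρ) (h.1 μ hμ) he hI
  have he' : ∀ i, e (τ i) ≤ 1 := fun i => he _
  have hsum : ∑ i, e (τ i) = ∑ i, e i := Equiv.sum_comp τ e
  have hμρ : μ = ρ := by
    by_contra hne
    rcases tildeOf_le_or_le he' hle with h1 | ⟨-, h1⟩
    · have h2 := lt_of_not_preceq hle h1 fun hp => hne (hmax μ hμ hp)
      omega
    · exact hne (h.eq_of_le hρ hμ h1).symm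
  subst hμρ
  refine ⟨fun i hi => ?_, hsum ▸ le_sum_add_ellInf hle⟩
  obtain ⟨j, rfl⟩ := τ.surjective i
  rw [hτ] at hi
  have hj : μ j ≠ ⊤ := fun hj => hi (tildeOf_of_eq_top hj)
  have h1 := le_of_coe_le_of_ne_top (hle j) hj
  rw [tildeOf_of_ne_top hj] at h1
  have h2 := he' j
  omega

end Ideals

end DualGenerators

section BlockStructure

lemma cumsum_mono (p : ℕ → ℕ) : Monotone (cumsum p) := fun _ _ h =>
  Finset.sum_le_sum_of_subset (Finset.range_subset_range.mpr h)

lemma blkOf_le {p : ℕ → ℕ} {k i : ℕ} (s : ℕ) (h : i < cumsum p (k + 1)) : blkOf p s i ≤ k := by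
  rw [← Finset.card_range k]
  refine Finset.card_le_card fun j hj => Finset.mem_range.mpr ?_
  by_contra! hkj
  have := cumsum_mono p (show k + 1 ≤ j + 1 by omega)
  have := (Finset.mem_filter.mp hj).2
  omega

lemma le_blkOf {p : ℕ → ℕ} {s k i : ℕ} (hk : k ≤ s) (h : cumsum p k ≤ i) : k ≤ blkOf p s i := by
  rw [← Finset.card_range k]
  refine Finset.card_le_card fun j hj => Finset.mem_filter.mpr ?_
  rw [Finset.mem_range] at hj
  exact ⟨Finset.mem_range.mpr (by omega), (cumsum_mono p hj).trans h⟩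

variable {s : ℕ} {d p : ℕ → ℕ}

lemma rhoOf_eq_top {i : ℕ} (h : i < p 0) : rhoOf s d p i = ⊤ := by
  refine if_pos (Nat.le_zero.mp (blkOf_le _ ?_))
  simpa [cumsum] using h

lemma rhoOf_eq_first {i : ℕ} (h0 : p 0 ≤ i) (h1 : i < p 0 + p 1) :
    rhoOf s d p i = (d 1 : ℕ∞) := by
  have hblk : blkOf p (s + 1) i = 1 := by
    refine le_antisymm (blkOf_le _ ?_) (le_blkOf (by omega) ?_)
    · simpa [cumsum, Finset.sum_range_succ] using h1
    · simpa [cumsum] using h0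
  rw [rhoOf, hblk, if_neg one_ne_zero]

lemma rhoOf_eq_lower (hd : ∀ k, 1 ≤ k → k + 1 ≤ s → d (k + 1) < d k) (hs : 1 ≤ s) {i : ℕ}
    (h0 : p 0 + p 1 ≤ i) (h1 : i < cumsum p (s + 1)) :
    ∃ m : ℕ, m < d 1 ∧ rhoOf s d p i = (m : ℕ∞) := by
  have hblk1 : blkOf p (s + 1) i ≤ s := blkOf_le _ h1
  have hblk2 : 2 ≤ blkOf p (s + 1) i := by
    refine le_blkOf (by omega) ?_
    simpa [cumsum, Finset.sum_range_succ] using h0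
  refine ⟨d (blkOf p (s + 1) i), ?_, if_neg (by omega)⟩
  have hlt : ∀ k, 2 ≤ k → k ≤ s → d k < d 1 := by
    intro k hk
    induction k, hk using Nat.le_induction with
    | base => exact hd 1 le_rfl
    | succ k hk ih => exact fun hks => (hd k (by omega) hks).trans (ih (by omega))
  exact hlt _ hblk2 hblk1

end BlockStructure

lemma Qgen_eq_bot (K : Type) [Field K] {n : ℕ} {μ : Fin n → ℕ∞} (h : ∀ i, μ i = ⊤) :
    Qgen K n μ = ⊥ := by
  refine eq_bot_iff.mpr ((iInf_le _ (Equiv.refl _)).trans ?_)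
  have hempty : {g : MvPolynomial (Fin n) K |
      ∃ i : Fin n, μ i ≠ ⊤ ∧ g = MvPolynomial.X i ^ ((μ i).toNat + 1)} = ∅ :=
    Set.eq_empty_of_forall_notMem fun g ⟨i, hi, _⟩ => hi (h i)
  rw [hempty, Ideal.span_empty, Ideal.map_bot]

lemma eF_le_one (F : Finset ℕ) (j : ℕ) : eF F j ≤ 1 := by
  unfold eF
  split_ifs <;> omega

lemma eF_eq_one_iff {F : Finset ℕ} {j : ℕ} : eF F j = 1 ↔ j ∈ F := by
  simp [eF]

lemma sum_eF {n : ℕ} {F : Finset ℕ} (h : F ⊆ Finset.range n) :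
    ∑ i : Fin n, eF F i.val = F.card := by
  rw [Fin.sum_univ_eq_sum_range (eF F) n]
  simp only [eF]
  rw [Finset.sum_ite_mem, Finset.inter_eq_right.mpr h, Finset.sum_const, smul_eq_mul, mul_one]

/-- Let `I` be a nonzero, proper `S_n`-invariant monomial ideal and
`ρ = (∞^{p_0}, d_1^{p_1}, …, d_s^{p_s}) ∈ Λ*_max(I)` a maximal dual generator, with
`∞ > d_1 > ⋯ > d_s ≥ 0`.  Then the multigraded Betti number
`β_{n-p_0, ρ̃}(R/I) = dim_k Tor_{n-p_0}(R/I, k)_{ρ̃}` equals `C(p_0 + p_1 - 1, p_0)`. -/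
theorem statement_9 (K : Type) [Field K] (n : ℕ) (I : Ideal (MvPolynomial (Fin n) K))
    (hmon : IsMonomialIdeal K n I) (hsym : IsSymmetricIdeal K n I)
    (hne : I ≠ ⊥) (hproper : I ≠ ⊤)
    (Λ : Finset (Fin n → ℕ∞)) (hpres : IsDualPresentation K n I Λ)
    (s : ℕ) (d p : ℕ → ℕ)
    (hn : n = cumsum p (s + 1))
    (hd : ∀ k, 1 ≤ k → k + 1 ≤ s → d (k + 1) < d k)
    (hp : ∀ k, 1 ≤ k → k ≤ s → 0 < p k)
    (ρ : Fin n → ℕ∞) (hρdef : ρ = fun i => rhoOf s d p i.val)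
    (hρΛ : ρ ∈ Λ) (hmax : ∀ μ ∈ Λ, preceq n ρ μ → μ = ρ) :
    torQDim K n I (n - p 0) (tildeOf n ρ) = Nat.choose (p 0 + p 1 - 1) (p 0) := by
 
  have hs : 1 ≤ s := by
    by_contra! hs
    obtain rfl : s = 0 := by omega
    refine hne (eq_bot_iff.mpr ?_)
    rw [← Qgen_eq_bot K (μ := ρ), hpres.2.1]
    · exact iInf₂_le ρ hρΛ
    · intro i
      rw [hρdef]
      refine rhoOf_eq_top ?_
      have hi := i.isLt
      simpa [hn, cumsum] using hi
  have hp1 : 0 < p 1 := hp 1 le_rfl hs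
  have hpn : p 0 + p 1 ≤ n := by
    have h := cumsum_mono p (show 2 ≤ s + 1 by omega)
    rw [← hn] at h
    simpa [cumsum, Finset.sum_range_succ] using h
  have htop : ∀ i : Fin n, i.val < p 0 → ρ i = ⊤ := by
    intro i hi
    rw [hρdef]
    exact rhoOf_eq_top hi
  have hfirst : ∀ i : Fin n, p 0 ≤ i.val → i.val < p 0 + p 1 → ρ i = (d 1 : ℕ∞) := by
    intro i h0 h1
    rw [hρdef]
    exact rhoOf_eq_first h0 h1
  have hlower : ∀ i : Fin n, p 0 + p 1 ≤ i.val → ∃ m : ℕ, m < d 1 ∧ ρ i = (m : ℕ∞) := by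
    intro i hi
    rw [hρdef]
    exact rhoOf_eq_lower hd hs hi (hn ▸ i.isLt)
  have hell : ellInf n ρ = p 0 := by
    have hfilter : (Finset.univ.filter fun i : Fin n => ρ i = ⊤) =
        Finset.univ.filter fun i : Fin n => i.val < p 0 := by
      refine Finset.filter_congr fun i _ => ⟨fun hi => ?_, htop i⟩
      by_contra! h0
      rcases lt_or_ge i.val (p 0 + p 1) with h1 | h1
      · rw [hfirst i h0 h1] at hi
        exact ENat.natCast_ne_top _ hi
      · obtain ⟨m, -, hm⟩ := hlower i h1
        rw [hm] at hi
        exact ENat.natCast_ne_top _ hi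
    rw [ellInf, hfilter, Fin.card_filter_val_lt]
    omega
  have htopVal : topVal n ρ = d 1 := by
    refine le_antisymm (Finset.sup_le fun i _ => ?_) ?_
    · rcases lt_or_ge i.val (p 0) with h0 | h0
      · simp [htop i h0]
      rcases lt_or_ge i.val (p 0 + p 1) with h1 | h1
      · simp [hfirst i h0 h1]
      · obtain ⟨m, hlt, hm⟩ := hlower i h1
        simpa [hm] using hlt.le
    · have h := toNat_le_topVal ρ ⟨p 0, by omega⟩
      rwa [hfirst _ le_rfl (by dsimp only; omega), ENat.toNat_natCast] at h
  have htilde : ∀ i : Fin n, tildeOf n ρ i ≠ topVal n ρ + 1 ↔ p 0 + p 1 ≤ i.val := by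
    intro i
    rw [htopVal]
    constructor
    · intro hi
      by_contra! h1
      refine hi ?_
      rcases lt_or_ge i.val (p 0) with h0 | h0
      · rw [tildeOf_of_eq_top (htop i h0), htopVal]
      · have h := hfirst i h0 h1
        rw [tildeOf_of_ne_top (by rw [h]; exact ENat.natCast_ne_top _), h, ENat.toNat_natCast]
    · intro hi
      obtain ⟨m, hlt, hm⟩ := hlower i hi
      rw [tildeOf_of_ne_top (by rw [hm]; exact ENat.natCast_ne_top _), hm, ENat.toNat_natCast]
      omega
  have hRF : ∀ F : Finset ℕ, (∀ i : Fin n, tildeOf n ρ i ≠ topVal n ρ + 1 → eF F i.val = 1) ↔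
      Finset.Ico (p 0 + p 1) n ⊆ F := by
    intro F
    simp only [htilde, eF_eq_one_iff]
    constructor
    · intro h j hj
      rw [Finset.mem_Ico] at hj
      exact h ⟨j, hj.2⟩ hj.1
    · exact fun h i hi => h (Finset.mem_Ico.mpr ⟨hi, i.isLt⟩)
  have hmem : ∀ F : Finset ℕ, F ⊆ Finset.range n → Finset.Ico (p 0 + p 1) n ⊆ F →
      n ≤ F.card + p 0 → F ∈ KosQ K n I (tildeOf n ρ) := by
    intro F hF hR hc
    refine ⟨hF, fun i _ => tildeOf_pos ρ i, ?_⟩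
    refine hpres.mon_tildeOf_sub_notMem hρΛ (fun i => eF_le_one F i.val) ((hRF F).mpr hR) ?_
    rwa [sum_eF hF, hell]
  have hof : ∀ F ∈ KosQ K n I (tildeOf n ρ), F.card + p 0 ≤ n →
      Finset.Ico (p 0 + p 1) n ⊆ F ∧ n ≤ F.card + p 0 := by
    rintro F ⟨hF, -, hI⟩ hc
    have h := hpres.of_mon_tildeOf_sub_notMem hρΛ hmax (fun i => eF_le_one F i.val)
      (by rwa [sum_eF hF, hell]) hI
    rwa [hRF, sum_eF hF, hell] at h
  have hmain := rhd0_eq_choose K (KosQ K n I (tildeOf n ρ)) (Finset.range n)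
    (Finset.Ico (p 0 + p 1) n)
    (fun j hj => Finset.mem_range.mpr (Finset.mem_Ico.mp hj).2) (p 0)
    (Finset.mem_range.mpr (by omega)) (fun h => by have := (Finset.mem_Ico.mp h).1; omega) (n - p 0 - 1)
    (by rw [Nat.card_Ico]; omega) (fun F hF => hF.1)
    (fun F hF hc => by have := (hof F hF (by omega)).2; omega)
    (fun F hc => ⟨fun hF => ⟨(hof F hF (by omega)).1, hF.1⟩,
      fun hF => hmem F hF.2 hF.1 (by omega)⟩)
    (fun F hc hR hF => hmem F hF hR (by omega))
  rw [Finset.card_range, Nat.card_Ico, show n - p 0 - 1 + 1 = n - p 0 by omega,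
    show n - (n - (p 0 + p 1)) - 1 = p 0 + p 1 - 1 by omega,
    show n - p 0 - 1 - (n - (p 0 + p 1)) = p 1 - 1 by omega] at hmain
  rw [torQDim, hmain]
  exact Nat.choose_symm_of_eq_add (by omega)
end
end
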